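/- arXiv:1810.05129 — 5 statements merged into one kernel-verified Lean document; each statement's English description precedes it below -/
import Mathlib

section
/- For every x > x_*, there exist K ∈ ℕ and ε > 0 such that for all sufficiently large N the following deterministic statement holds: for every function X: T_N → ℝ with X_∅ = 0, every vertex v ∈ V_N with X_v ≥ x·N has an (ε,K,X)-steep ancestor. -/
open MeasureTheory Set Filter

/-- Riemann integrability of `a` on `[0,1]`, encoded via the Lebesgue criterion:
`a` is bounded on `[0,1]`, almost everywhere continuous on `[0,1]`, and (Lebesgue)
integrable on `[0,1]`. -/
def RiemannIntegrableOn01 (a : ℝ → ℝ) : Prop :=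
  IntegrableOn a (Set.Icc 0 1) volume ∧
  (∀ᵐ s ∂(volume.restrict (Set.Icc (0:ℝ) 1)), ContinuousAt a s) ∧
  ∃ C : ℝ, ∀ s ∈ Set.Icc (0:ℝ) 1, |a s| ≤ C

/-- Vertices of the rooted binary tree are binary strings, encoded as `List Bool`;
the root is `[]`, the generation `|v|` of `v` is `v.length`, and the generation-`m`
ancestor `v[m]` of `v` is `v.take m`.

`IsSteep N K ε A X v` says that the vertex `v` is `(ε,K,X)`-steep: there is
`k ∈ {1,…,K}` with `|v| = ⌊Nk/K⌋` and
`X v - X (v[⌊N(k-1)/K⌋]) ≥ N·√((1+ε)·(2 log 2)·(A(k/K) - A((k-1)/K))/K)`. -/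
def IsSteep (N K : ℕ) (ε : ℝ) (A : ℝ → ℝ) (X : List Bool → ℝ) (v : List Bool) : Prop :=
  ∃ k ∈ Finset.Icc 1 K, v.length = N * k / K ∧
    (N : ℝ) * Real.sqrt ((1 + ε) * (2 * Real.log 2) * (A (k / K) - A ((k - 1 : ℝ) / K)) / K)
      ≤ X v - X (v.take (N * (k - 1) / K))

/-- The step function equal, on the cell `[k/K, (k+1)/K)`, to the square root of the mean slope
of `A` over that cell. -/
noncomputable def sqrtSlope (A : ℝ → ℝ) (K : ℕ) (t : ℝ) : ℝ :=
  Real.sqrt (K * (A (((⌊K * t⌋₊ : ℕ) + 1 : ℝ) / K) - A ((⌊K * t⌋₊ : ℕ) / K)))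

lemma measurable_sqrtSlope (A : ℝ → ℝ) (K : ℕ) : Measurable (sqrtSlope A K) := by
  have h : Measurable fun n : ℕ =>
      Real.sqrt (K * (A (((n : ℕ) + 1 : ℝ) / K) - A ((n : ℕ) / K))) := measurable_from_nat
  exact h.comp (Nat.measurable_floor.comp (measurable_const_mul (K : ℝ)))

/-- A half-open cell of the uniform partition containing `t ∈ [0,1)` lies in `[0,1]`. -/
lemma floor_cell {K : ℕ} (hK : 0 < K) {t : ℝ} (ht0 : 0 ≤ t) (ht1 : t < 1) :
    0 ≤ (⌊K * t⌋₊ : ℝ) / K ∧ (⌊K * t⌋₊ : ℝ) / K ≤ t ∧ t < ((⌊K * t⌋₊ : ℝ) + 1) / K ∧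
      ((⌊K * t⌋₊ : ℝ) + 1) / K ≤ 1 := by
  have hK' : (0 : ℝ) < K := Nat.cast_pos.2 hK
  have h0 : 0 ≤ K * t := by positivity
  refine ⟨by positivity, ?_, ?_, ?_⟩
  · rw [div_le_iff₀' hK']
    exact Nat.floor_le h0
  · rw [lt_div_iff₀' hK']
    exact Nat.lt_floor_add_one _
  · rw [div_le_one hK']
    have : ⌊K * t⌋₊ < K := (Nat.floor_lt h0).2 (by nlinarith)
    exact_mod_cast this

/-- Increments of the primitive are close to the increment length times a constant close
to the integrand. -/
lemma abs_primitive_sub_le {a A : ℝ → ℝ} (ha : IntegrableOn a (Set.Icc 0 1) volume)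
    (hA : ∀ t ∈ Set.Icc (0:ℝ) 1, A t = ∫ s in (0:ℝ)..t, a s) {u w c δ : ℝ}
    (hu : 0 ≤ u) (huw : u ≤ w) (hw : w ≤ 1) (h : ∀ s ∈ Set.Icc u w, |a s - c| ≤ δ) :
    |A w - A u - (w - u) * c| ≤ δ * (w - u) := by
  have hint : ∀ p q : ℝ, 0 ≤ p → p ≤ q → q ≤ 1 → IntervalIntegrable a volume p q := by
    intro p q hp hpq hq
    rw [intervalIntegrable_iff_integrableOn_Icc_of_le hpq]
    exact ha.mono_set (Set.Icc_subset_Icc hp hq)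
  have huw' := hint u w hu huw hw
  have e1 : A w - A u = ∫ s in u..w, a s := by
    rw [hA w ⟨hu.trans huw, hw⟩, hA u ⟨hu, huw.trans hw⟩]
    exact intervalIntegral.integral_interval_sub_left (hint 0 w le_rfl (hu.trans huw) hw)
      (hint 0 u le_rfl hu (huw.trans hw))
  have e2 : A w - A u - (w - u) * c = ∫ s in u..w, (a s - c) := by
    rw [intervalIntegral.integral_sub huw' intervalIntegrable_const, e1,
      intervalIntegral.integral_const, smul_eq_mul]
  rw [e2, ← Real.norm_eq_abs]
  have := intervalIntegral.norm_integral_le_of_norm_le_const (a := u) (b := w)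
    (f := fun s => a s - c) (C := δ) (by
      intro s hs
      rw [Set.uIoc_of_le huw] at hs
      exact h s ⟨hs.1.le, hs.2⟩)
  rwa [abs_of_nonneg (sub_nonneg.2 huw)] at this

lemma sqrtSlope_le {a A : ℝ → ℝ} (ha : IntegrableOn a (Set.Icc 0 1) volume)
    (hA : ∀ t ∈ Set.Icc (0:ℝ) 1, A t = ∫ s in (0:ℝ)..t, a s) {C : ℝ}
    (hC : ∀ s ∈ Set.Icc (0:ℝ) 1, |a s| ≤ C) {K : ℕ} (hK : 0 < K) {t : ℝ}
    (ht0 : 0 ≤ t) (ht1 : t < 1) : sqrtSlope A K t ≤ Real.sqrt C := by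
  obtain ⟨h1, h2, h3, h4⟩ := floor_cell hK ht0 ht1
  have hK' : (0 : ℝ) < K := Nat.cast_pos.2 hK
  have := abs_primitive_sub_le ha hA h1 (h2.trans h3.le) h4 (c := 0) (δ := C)
    (fun s hs => by simpa using hC s ⟨h1.trans hs.1, hs.2.trans h4⟩)
  rw [← sub_div, add_sub_cancel_left, mul_zero, sub_zero] at this
  refine Real.sqrt_le_sqrt ?_
  calc _ ≤ K * (C * (1 / K)) := mul_le_mul_of_nonneg_left ((le_abs_self _).trans this) hK'.le
    _ = C := by field_simp

lemma tendsto_sqrtSlope {a A : ℝ → ℝ} (ha : IntegrableOn a (Set.Icc 0 1) volume)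
    (hA : ∀ t ∈ Set.Icc (0:ℝ) 1, A t = ∫ s in (0:ℝ)..t, a s) {t : ℝ}
    (ht0 : 0 ≤ t) (ht1 : t < 1) (hc : ContinuousAt a t) :
    Tendsto (fun K => sqrtSlope A K t) atTop (nhds (Real.sqrt (a t))) := by
  refine (Real.continuous_sqrt.tendsto _).comp ?_
  rw [Metric.tendsto_atTop]
  intro e he
  obtain ⟨d, hd, hd'⟩ := Metric.continuousAt_iff.1 hc (e / 2) (by positivity)
  obtain ⟨n, hn⟩ := exists_nat_gt (1 / d)
  refine ⟨n + 1, fun K hK => ?_⟩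
  have hKpos : 0 < K := by omega
  have hK' : (0 : ℝ) < K := Nat.cast_pos.2 hKpos
  have hKd : 1 / (K : ℝ) < d := by
    rw [div_lt_comm₀ hK' hd]
    exact hn.trans (by exact_mod_cast hK)
  obtain ⟨h1, h2, h3, h4⟩ := floor_cell hKpos ht0 ht1
  have hlen : ((⌊K * t⌋₊ : ℝ) + 1) / K - (⌊K * t⌋₊ : ℝ) / K = 1 / K := by
    rw [← sub_div, add_sub_cancel_left]
  have := abs_primitive_sub_le ha hA h1 (h2.trans h3.le) h4 (c := a t) (δ := e / 2)
    (fun s hs => by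
      refine (hd' ?_).le
      rw [Real.dist_eq, abs_lt]
      constructor <;> linarith [hs.1, hs.2])
  rw [hlen] at this
  rw [Real.dist_eq]
  set D := A (((⌊K * t⌋₊ : ℝ) + 1) / K) - A ((⌊K * t⌋₊ : ℝ) / K)
  calc |K * D - a t| = K * |D - 1 / K * a t| := by
        rw [← abs_of_pos hK', ← abs_mul, abs_of_pos hK']
        congr 1
        field_simp
    _ ≤ K * (e / 2 * (1 / K)) := mul_le_mul_of_nonneg_left this hK'.le
    _ = e / 2 := by field_simp
    _ < e := by linarith

lemma tendsto_integral_sqrtSlope {a A : ℝ → ℝ} (ha : RiemannIntegrableOn01 a)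
    (hA : ∀ t ∈ Set.Icc (0:ℝ) 1, A t = ∫ s in (0:ℝ)..t, a s) :
    Tendsto (fun K => ∫ t in (0:ℝ)..1, sqrtSlope A K t) atTop
      (nhds (∫ t in (0:ℝ)..1, Real.sqrt (a t))) := by
  obtain ⟨hint, hcont, C, hC⟩ := ha
  have hne : ∀ᵐ t : ℝ ∂volume, t ≠ 1 := Measure.ae_ne volume 1
  refine intervalIntegral.tendsto_integral_filter_of_dominated_convergence
    (fun _ => Real.sqrt C) (.of_forall fun K => (measurable_sqrtSlope A K).aestronglyMeasurable)
    ?_ intervalIntegrable_const ?_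
  · filter_upwards [eventually_gt_atTop 0] with K hK
    filter_upwards [hne] with t ht ht'
    rw [Set.uIoc_of_le zero_le_one] at ht'
    rw [Real.norm_eq_abs, abs_of_nonneg (show 0 ≤ sqrtSlope A K t from Real.sqrt_nonneg _)]
    exact sqrtSlope_le hint hA hC hK ht'.1.le (lt_of_le_of_ne ht'.2 ht)
  · rw [ae_restrict_iff' measurableSet_Icc] at hcont
    filter_upwards [hne, hcont] with t ht htc ht'
    rw [Set.uIoc_of_le zero_le_one] at ht'
    exact tendsto_sqrtSlope hint hA ht'.1.le (lt_of_le_of_ne ht'.2 ht) (htc ⟨ht'.1.le, ht'.2⟩)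

lemma integral_sqrtSlope (A : ℝ → ℝ) {K : ℕ} (hK : 0 < K) :
    ∫ t in (0:ℝ)..1, sqrtSlope A K t =
      ∑ k ∈ Finset.range K, 1 / (K : ℝ) * Real.sqrt (K * (A ((k + 1 : ℝ) / K) - A (k / K))) := by
  have hK' : (0 : ℝ) < K := Nat.cast_pos.2 hK
  have hcell : ∀ k : ℕ, Set.EqOn (sqrtSlope A K)
      (fun _ => Real.sqrt (K * (A ((k + 1 : ℝ) / K) - A (k / K))))
      (Set.Ioo ((k : ℝ) / K) (((k + 1 : ℕ) : ℝ) / K)) := by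
    intro k t ht
    have h0 : (k : ℝ) ≤ K * t := by
      rw [mul_comm]; exact ((div_lt_iff₀ hK').1 ht.1).le
    have h1 : K * t < (k : ℝ) + 1 := by
      have := (lt_div_iff₀ hK').1 ht.2
      push_cast at this
      linarith
    have hfl : ⌊K * t⌋₊ = k := (Nat.floor_eq_iff (k.cast_nonneg.trans h0)).2 ⟨h0, h1⟩
    simp only [sqrtSlope, hfl]
  have hle : ∀ k : ℕ, (k : ℝ) / K ≤ ((k + 1 : ℕ) : ℝ) / K := by
    intro k; gcongr; simp
  have hsum := intervalIntegral.sum_integral_adjacent_intervals (μ := volume)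
    (f := sqrtSlope A K) (a := fun k : ℕ => (k : ℝ) / K) (n := K) (by
      intro k _
      rw [intervalIntegrable_iff_integrableOn_Ioo_of_le (hle k)]
      exact (integrableOn_congr_fun (hcell k) measurableSet_Ioo).2
        (integrableOn_const (by simp)))
  simp only [Nat.cast_zero, zero_div, div_self hK'.ne'] at hsum
  rw [← hsum]
  refine Finset.sum_congr rfl fun k _ => ?_
  rw [intervalIntegral.integral_of_le (hle k), integral_Ioc_eq_integral_Ioo,
    setIntegral_congr_fun measurableSet_Ioo (hcell k), ← integral_Ioc_eq_integral_Ioo,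
    ← intervalIntegral.integral_of_le (hle k), intervalIntegral.integral_const, smul_eq_mul,
    ← sub_div]
  push_cast
  rw [add_sub_cancel_left]

/-- If the step thresholds sum to at most `x`, a path reaching `x * N` takes a steep step. -/
lemma exists_steep_of_sum_le {N K : ℕ} (hK : 0 < K) {ε x : ℝ} {A : ℝ → ℝ}
    (hx : ∑ k ∈ Finset.range K,
      Real.sqrt ((1 + ε) * (2 * Real.log 2) * (A ((k + 1 : ℝ) / K) - A (k / K)) / K) ≤ x)
    {X : List Bool → ℝ} (hX : X [] = 0) {v : List Bool} (hv : v.length = N)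
    (hXv : x * N ≤ X v) : ∃ m ≤ N, IsSteep N K ε A X (v.take m) := by
  by_contra! hcon
  have hstep : ∀ k ∈ Finset.range K,
      X (v.take (N * (k + 1) / K)) - X (v.take (N * k / K)) <
      N * Real.sqrt ((1 + ε) * (2 * Real.log 2) * (A ((k + 1 : ℝ) / K) - A (k / K)) / K) := by
    intro k hk
    have hkK : k + 1 ≤ K := Finset.mem_range.1 hk
    have hm : N * (k + 1) / K ≤ N := Nat.div_le_of_le_mul (by nlinarith)
    have hmm : N * k / K ≤ N * (k + 1) / K := Nat.div_le_div_right (by nlinarith)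
    by_contra! hle
    refine hcon _ hm ⟨k + 1, Finset.mem_Icc.2 ⟨by omega, hkK⟩, ?_, ?_⟩
    · rw [List.length_take, hv, min_eq_left hm]
    · rw [Nat.add_sub_cancel, List.take_take, min_eq_left hmm]
      push_cast
      rwa [add_sub_cancel_right]
  have hlt := Finset.sum_lt_sum_of_nonempty (Finset.nonempty_range_iff.2 hK.ne') hstep
  rw [Finset.sum_range_sub (fun k => X (v.take (N * k / K))), ← Finset.mul_sum,
    Nat.mul_div_cancel _ hK, ← hv, List.take_length] at hlt
  simp only [mul_zero, Nat.zero_div, List.take_zero, hX, sub_zero] at hlt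
  rw [hv] at hlt
  have := mul_le_mul_of_nonneg_left hx (Nat.cast_nonneg (α := ℝ) N)
  linarith

theorem stmt3 (a A : ℝ → ℝ)
    (ha_nonneg : ∀ s ∈ Set.Icc (0:ℝ) 1, 0 ≤ a s)
    (ha_int : RiemannIntegrableOn01 a)
    (hA : ∀ t ∈ Set.Icc (0:ℝ) 1, A t = ∫ s in (0:ℝ)..t, a s)
    (hA1 : A 1 = 1)
    (x : ℝ) (hx : Real.sqrt (2 * Real.log 2) * (∫ t in (0:ℝ)..1, Real.sqrt (a t)) < x) :
    ∃ K : ℕ, 0 < K ∧ ∃ ε : ℝ, 0 < ε ∧ ∃ N₀ : ℕ, ∀ N ≥ N₀,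
      ∀ X : List Bool → ℝ, X [] = 0 →
        ∀ v : List Bool, v.length = N → x * N ≤ X v →
          ∃ m ≤ N, IsSteep N K ε A X (v.take m) := by
  have hlim := (tendsto_integral_sqrtSlope ha_int hA).const_mul (Real.sqrt (2 * Real.log 2))
  obtain ⟨K, hKx, hK⟩ := ((hlim.eventually_lt_const hx).and (eventually_gt_atTop 0)).exists
  have hK' : (0 : ℝ) < K := Nat.cast_pos.2 hK
  have hzero : ∑ k ∈ Finset.range K, Real.sqrt ((1 + (0 : ℝ)) * (2 * Real.log 2) *
      (A ((k + 1 : ℝ) / K) - A (k / K)) / K) < x := by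
    rw [integral_sqrtSlope A hK, Finset.mul_sum] at hKx
    refine lt_of_eq_of_lt (Finset.sum_congr rfl fun k _ => ?_) hKx
    have hlog : 0 ≤ 2 * Real.log 2 := by positivity
    set D := A ((k + 1 : ℝ) / K) - A (k / K)
    have e : (1 + (0 : ℝ)) * (2 * Real.log 2) * D / K =
        2 * Real.log 2 * ((1 / (K : ℝ)) ^ 2 * (K * D)) := by
      field_simp
      ring
    rw [e, Real.sqrt_mul hlog, Real.sqrt_mul (sq_nonneg (1 / (K : ℝ))), Real.sqrt_sq (by positivity)]
  have hcont : Continuous fun ε : ℝ => ∑ k ∈ Finset.range K, Real.sqrt ((1 + ε) *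
      (2 * Real.log 2) * (A ((k + 1 : ℝ) / K) - A (k / K)) / K) := by
    fun_prop
  obtain ⟨ε, hε, hεpos⟩ := (((hcont.tendsto 0).eventually_lt_const hzero).filter_mono
    (nhdsWithin_le_nhds (s := Set.Ioi 0))).and self_mem_nhdsWithin |>.exists
  exact ⟨K, hK, ε, hεpos, 0, fun N _ X hX v hv hXv =>
    exists_steep_of_sum_le hK hε.le hX hv hXv⟩
end

section
/- lim_{K→∞} Σ_{k=1}^K √((A(k/K) − A((k−1)/K))/K) = ∫₀¹ √(a(s)) ds. -/
open MeasureTheory Set Filter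

lemma abs_mul_integral_sub_le {a : ℝ → ℝ} {x y c ε r : ℝ} (hr : 0 < r) (hxy : r * (y - x) = 1)
    (ha : IntervalIntegrable a volume x y) (h : ∀ u ∈ Icc x y, |a u - c| ≤ ε) :
    |r * (∫ u in x..y, a u) - c| ≤ ε := by
  have hle : 0 < y - x := pos_of_mul_pos_right (by rw [hxy]; exact one_pos) hr.le
  have hsub : ∫ u in x..y, (a u - c) = (∫ u in x..y, a u) - (y - x) * c := by
    rw [intervalIntegral.integral_sub ha intervalIntegrable_const,
      intervalIntegral.integral_const, smul_eq_mul]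
  have hbound : ‖∫ u in x..y, (a u - c)‖ ≤ ε * |y - x| := by
    apply intervalIntegral.norm_integral_le_of_norm_le_const
    intro u hu
    rw [uIoc_of_le (by linarith)] at hu
    exact h u (Ioc_subset_Icc_self hu)
  have heq : r * (∫ u in x..y, a u) - c = r * ∫ u in x..y, (a u - c) := by
    rw [hsub]
    linear_combination c * hxy
  rw [heq, abs_mul, abs_of_pos hr]
  rw [Real.norm_eq_abs, abs_of_pos hle] at hbound
  calc r * |∫ u in x..y, (a u - c)| ≤ r * (ε * (y - x)) := by gcongr
    _ = ε := by linear_combination ε * hxy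

lemma integral_comp_floor_mul (f : ℕ → ℝ) {K : ℕ} (hK : 0 < K) :
    ∫ s in (0:ℝ)..1, f ⌊(K:ℝ) * s⌋₊ = ∑ k ∈ Finset.range K, f k / K := by
  have hK' : (0:ℝ) < K := by exact_mod_cast hK
  have hlt : ∀ k : ℕ, (k:ℝ) / K ≤ ((k + 1 : ℕ) : ℝ) / K := fun k => by
    gcongr
    simp
  have hcongr : ∀ k : ℕ, ∀ s ∈ Ioo ((k:ℝ) / K) (((k + 1 : ℕ) : ℝ) / K),
      f ⌊(K:ℝ) * s⌋₊ = f k := by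
    intro k s hs
    rw [mem_Ioo, div_lt_iff₀ hK', lt_div_iff₀ hK'] at hs
    push_cast at hs
    rw [(Nat.floor_eq_iff (by linarith [hs.1, k.cast_nonneg (α := ℝ)])).2
      ⟨by linarith [hs.1], by linarith [hs.2]⟩]
  have hint : ∀ k : ℕ, IntervalIntegrable (fun s : ℝ => f ⌊(K:ℝ) * s⌋₊) volume
      ((k:ℝ) / K) (((k + 1 : ℕ) : ℝ) / K) := by
    intro k
    rw [intervalIntegrable_iff_integrableOn_Ioo_of_le (hlt k)]
    exact (integrableOn_const (C := f k) (by simp)).congr_fun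
      (fun s hs => (hcongr k s hs).symm) measurableSet_Ioo
  have hsum := intervalIntegral.sum_integral_adjacent_intervals
    (a := fun k : ℕ => (k:ℝ) / K) (n := K) (fun k _ => hint k)
  simp only [Nat.cast_zero, zero_div, div_self hK'.ne'] at hsum
  rw [← hsum]
  refine Finset.sum_congr rfl fun k _ => ?_
  rw [intervalIntegral.integral_of_le (hlt k), integral_Ioc_eq_integral_Ioo,
    setIntegral_congr_fun measurableSet_Ioo (hcongr k), ← integral_Ioc_eq_integral_Ioo,
    ← intervalIntegral.integral_of_le (hlt k), intervalIntegral.integral_const, smul_eq_mul]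
  push_cast
  ring

theorem stmt5 (a A : ℝ → ℝ)
    (ha_nonneg : ∀ s ∈ Set.Icc (0:ℝ) 1, 0 ≤ a s)
    (ha_int : RiemannIntegrableOn01 a)
    (hA : ∀ t ∈ Set.Icc (0:ℝ) 1, A t = ∫ s in (0:ℝ)..t, a s)
    (hA1 : A 1 = 1) :
    Tendsto
      (fun K : ℕ => ∑ k ∈ Finset.Icc 1 K,
        Real.sqrt ((A (k / K) - A ((k - 1 : ℝ) / K)) / K))
      atTop (nhds (∫ s in (0:ℝ)..1, Real.sqrt (a s))) := by
  obtain ⟨hint, hcont, C, hC⟩ := ha_int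
  have hII : ∀ x ∈ Icc (0:ℝ) 1, ∀ y ∈ Icc (0:ℝ) 1, IntervalIntegrable a volume x y := by
    intro x hx y hy
    rw [intervalIntegrable_iff]
    exact hint.mono_set (uIoc_subset_uIcc.trans (uIcc_subset_Icc hx hy))
  have h0 : (0:ℝ) ∈ Icc (0:ℝ) 1 := by simp
  have hdiff : ∀ x ∈ Icc (0:ℝ) 1, ∀ y ∈ Icc (0:ℝ) 1, A y - A x = ∫ s in x..y, a s := by
    intro x hx y hy
    rw [hA x hx, hA y hy,
      intervalIntegral.integral_interval_sub_left (hII 0 h0 y hy) (hII 0 h0 x hx)]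
  set f : ℕ → ℕ → ℝ := fun K k =>
    Real.sqrt (K * (A (((k:ℝ) + 1) / K) - A ((k:ℝ) / K))) with hf
  have hsum : ∀ K : ℕ, 0 < K → ∫ s in (0:ℝ)..1, f K ⌊(K:ℝ) * s⌋₊ =
      ∑ k ∈ Finset.Icc 1 K, Real.sqrt ((A (k / K) - A ((k - 1 : ℝ) / K)) / K) := by
    intro K hK
    have hK' : (0:ℝ) < K := by exact_mod_cast hK
    rw [integral_comp_floor_mul (f K) hK, Finset.range_eq_Ico,
      ← Finset.Ico_add_one_right_eq_Icc, ← Finset.sum_Ico_add' _ 0 K 1]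
    refine Finset.sum_congr rfl fun k _ => ?_
    rw [hf, div_eq_iff hK'.ne', ← Real.sqrt_sq hK'.le, ← Real.sqrt_mul' _ (sq_nonneg _),
      Real.sqrt_sq hK'.le]
    push_cast
    rw [add_sub_cancel_right]
    field_simp
  have hcell : ∀ K : ℕ, 0 < K → ∀ s ∈ Ico (0:ℝ) 1, ∀ c ε : ℝ,
      (∀ u ∈ Icc (0:ℝ) 1, |u - s| ≤ 1 / K → |a u - c| ≤ ε) →
      |K * (A (((⌊(K:ℝ) * s⌋₊:ℝ) + 1) / K) - A ((⌊(K:ℝ) * s⌋₊:ℝ) / K)) - c| ≤ ε := by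
    intro K hK s hs c ε h
    have hK' : (0:ℝ) < K := by exact_mod_cast hK
    have hKs : 0 ≤ (K:ℝ) * s := mul_nonneg hK'.le hs.1
    have hn := Nat.floor_le hKs
    have hn1 := Nat.lt_floor_add_one ((K:ℝ) * s)
    have hnK : ⌊(K:ℝ) * s⌋₊ + 1 ≤ K :=
      (Nat.floor_lt hKs).2 (by nlinarith [hs.2])
    have hnK' : (⌊(K:ℝ) * s⌋₊ : ℝ) + 1 ≤ K := by exact_mod_cast hnK
    generalize ⌊(K:ℝ) * s⌋₊ = n at *
    have hx : (n:ℝ) / K ∈ Icc (0:ℝ) 1 :=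
      ⟨by positivity, (div_le_one hK').2 (by linarith)⟩
    have hy : ((n:ℝ) + 1) / K ∈ Icc (0:ℝ) 1 :=
      ⟨by positivity, (div_le_one hK').2 hnK'⟩
    rw [hdiff _ hx _ hy]
    refine abs_mul_integral_sub_le hK' (by field_simp; ring) (hII _ hx _ hy) fun u hu => ?_
    refine h u ⟨hx.1.trans hu.1, hu.2.trans hy.2⟩ ?_
    have h1 : (n:ℝ) / K ≤ s := (div_le_iff₀ hK').2 (by linarith)
    have h2 : s ≤ ((n:ℝ) + 1) / K := (le_div_iff₀ hK').2 (by linarith)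
    have h3 : ((n:ℝ) + 1) / K = n / K + 1 / K := add_div _ _ _
    rw [abs_le]
    constructor <;> linarith [hu.1, hu.2]
  have hae : ∀ᵐ s : ℝ, s ∈ uIoc (0:ℝ) 1 → s ∈ Ico (0:ℝ) 1 ∧ ContinuousAt a s := by
    rw [ae_restrict_iff' measurableSet_Icc] at hcont
    filter_upwards [hcont, Measure.ae_ne volume (1:ℝ)] with s hs hs1 hmem
    rw [uIoc_of_le zero_le_one] at hmem
    exact ⟨⟨hmem.1.le, lt_of_le_of_ne hmem.2 hs1⟩, hs ⟨hmem.1.le, hmem.2⟩⟩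
  have hlim : Tendsto (fun K : ℕ => ∫ s in (0:ℝ)..1, f K ⌊(K:ℝ) * s⌋₊) atTop
      (nhds (∫ s in (0:ℝ)..1, Real.sqrt (a s))) := by
    refine intervalIntegral.tendsto_integral_filter_of_dominated_convergence
      (fun _ => Real.sqrt C) ?_ ?_ intervalIntegrable_const ?_
    · refine Eventually.of_forall fun K => Measurable.aestronglyMeasurable ?_
      exact (measurable_from_top (f := f K)).comp
        (Nat.measurable_floor.comp (measurable_const.mul measurable_id))
    · filter_upwards [eventually_gt_atTop 0] with K hK
      filter_upwards [hae] with s hs hmem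
      rw [Real.norm_of_nonneg (Real.sqrt_nonneg _)]
      apply Real.sqrt_le_sqrt
      have := hcell K hK s (hs hmem).1 0 C (fun u hu _ => by simpa using hC u hu)
      rw [sub_zero] at this
      exact (le_abs_self _).trans this
    · filter_upwards [hae] with s hs hmem
      obtain ⟨hs1, hsc⟩ := hs hmem
      refine (Real.continuous_sqrt.tendsto (a s)).comp ?_
      rw [Metric.tendsto_nhds]
      intro ε hε
      obtain ⟨δ, hδ, hball⟩ := Metric.continuousAt_iff.1 hsc (ε / 2) (half_pos hε)
      filter_upwards [eventually_gt_atTop 0,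
        (tendsto_one_div_atTop_nhds_zero_nat (𝕜 := ℝ)).eventually_lt_const hδ] with K hK hKδ
      rw [Real.dist_eq]
      exact (hcell K hK s hs1 (a s) (ε / 2) fun u _ hus =>
        (hball (hus.trans_lt hKδ)).le).trans_lt (half_lt_self hε)
  refine hlim.congr' ?_
  filter_upwards [eventually_gt_atTop 0] with K hK using hsum K hK
end

section
/- For any measurable function g:[0,∞)→[0,∞) and any t ∈ (0,1]: ∫₀ᵗ g(â(x))·a(x) dx + g(â(t))·(Â(t) − A(t)) = ∫₀ᵗ g(â(x))·â(x) dx. -/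
open MeasureTheory Set Filter

/-- A left derivative of a concave function is a supergradient. -/
lemma ConcaveOn.le_add_mul_sub_of_hasDerivWithinAt_Iic {S : Set ℝ} {f : ℝ → ℝ} {f' x y z : ℝ}
    (hf : ConcaveOn ℝ S f) (hx : x ∈ S) (hy : y ∈ S) (hz : z ∈ S) (hzy : z < y)
    (hd : HasDerivWithinAt f f' (Iic y) y) : f x ≤ f y + f' * (x - y) := by
  have hd' : HasDerivWithinAt f f' (Iio y) y := hd.mono Iio_subset_Iic_self
  rcases lt_trichotomy x y with h | rfl | h
  · have := hf.le_slope_of_hasDerivWithinAt_Iio hx hy h hd'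
    rw [slope_def_field, le_div_iff₀ (by linarith)] at this
    linarith
  · simp
  · have key : (f x - f y) / (x - y) ≤ f' := by
      apply ge_of_tendsto <| (hasDerivWithinAt_iff_tendsto_slope' self_notMem_Iio).mp hd'
      filter_upwards [Ioo_mem_nhdsLT hzy] with w hw
      have hwS : w ∈ S := hf.1.ordConnected.out hz hy ⟨hw.1.le, hw.2.le⟩
      rw [slope_comm, slope_def_field]
      exact hf.slope_anti_adjacent hwS hx hw.2 h
    rw [div_le_iff₀ (by linarith)] at key
    linarith

/-- Fundamental theorem of calculus for left derivatives. -/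
lemma integral_eq_sub_of_hasDeriv_left_of_le {f f' : ℝ → ℝ} {a b : ℝ} (hab : a ≤ b)
    (hcont : ContinuousOn f (Icc a b))
    (hderiv : ∀ x ∈ Ioo a b, HasDerivWithinAt f (f' x) (Iio x) x)
    (hint : IntervalIntegrable f' volume a b) : ∫ x in a..b, f' x = f b - f a := by
  have h := intervalIntegral.integral_eq_sub_of_hasDeriv_right_of_le (a := -b) (b := -a)
    (f := fun x => -f (-x)) (f' := fun x => f' (-x)) (by linarith) ?_ ?_ ?_
  · rw [intervalIntegral.integral_comp_neg f'] at h
    simp only [neg_neg] at h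
    rw [h]
    ring
  · refine (hcont.comp continuousOn_neg fun x hx => ?_).neg
    exact ⟨by linarith [hx.2], by linarith [hx.1]⟩
  · intro x hx
    have h1 := hderiv (-x) ⟨by linarith [hx.2], by linarith [hx.1]⟩
    have h2 : HasDerivWithinAt (fun x : ℝ => -x) (-1) (Ioi x) x :=
      (hasDerivAt_neg x).hasDerivWithinAt
    have h3 := (h1.comp x h2 (fun w (hw : x < w) => neg_lt_neg hw)).neg
    rw [mul_neg_one, neg_neg] at h3
    exact h3
  · have := (IntervalIntegrable.iff_comp_neg (f := f') (a := a) (b := b)).mp hint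
    exact this.symm

/-- The least concave majorant `F` of `A` touches `A` at every point where the left derivative
of `F` jumps across a level `c` in the sense that it is at least `c` before and below `c` after. -/
lemma eq_of_least_concave_majorant {A F f : ℝ → ℝ} {s c : ℝ}
    (hAc : ContinuousOn A (Icc 0 1)) (hFc : ContinuousOn F (Icc 0 1))
    (hge : ∀ t ∈ Icc (0:ℝ) 1, A t ≤ F t)
    (hleast : ∀ g : ℝ → ℝ, ConcaveOn ℝ (Icc 0 1) g →
      (∀ t ∈ Icc (0:ℝ) 1, A t ≤ g t) → ∀ t ∈ Icc (0:ℝ) 1, F t ≤ g t)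
    (hsup : ∀ y ∈ Ioc (0:ℝ) 1, ∀ x ∈ Icc (0:ℝ) 1, F x ≤ F y + f y * (x - y))
    (hs : s ∈ Icc (0:ℝ) 1) (hlt : ∀ y ∈ Ioo 0 s, c ≤ f y) (hgt : ∀ y ∈ Ioc s 1, f y < c) :
    F s = A s := by
  by_contra hne
  have hcont : ContinuousWithinAt (fun x => F x - A x) (Icc 0 1) s := (hFc.sub hAc) s hs
  have hev := hcont.eventually_ne (sub_ne_zero.mpr hne)
  rw [eventually_nhdsWithin_iff, Metric.eventually_nhds_iff] at hev
  obtain ⟨δ, hδ, hnz⟩ := hev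
  obtain ⟨c', hc', y, hsy, hyδ, hy⟩ : ∃ c' < c, ∃ y, s ≤ y ∧ y < s + δ ∧
      ∀ x ∈ Icc (0:ℝ) 1, y < x → y ∈ Icc (0:ℝ) 1 ∧ F x - c' * x < F y - c' * y := by
    rcases hs.2.eq_or_lt with h1 | h1
    · exact ⟨c - 1, by linarith, s, le_rfl, by linarith, fun x hx hsx => by linarith [hx.2]⟩
    · obtain ⟨y, hy1, hy2⟩ := exists_between (lt_min h1 (by linarith : s < s + δ))
      have hy3 := hy2.trans_le (min_le_left _ _)
      have hy4 := hy2.trans_le (min_le_right _ _)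
      obtain ⟨c', h1, h2⟩ := exists_between (hgt y ⟨hy1, hy3.le⟩)
      refine ⟨c', h2, y, hy1.le, hy4, fun x hx hyx => ⟨⟨by linarith [hs.1], hy3.le⟩, ?_⟩⟩
      have := hsup y ⟨by linarith [hs.1], hy3.le⟩ x hx
      nlinarith
  obtain ⟨z, hz, hzmax⟩ := isCompact_Icc.exists_isMaxOn (nonempty_Icc.mpr (zero_le_one' ℝ))
    (hAc.sub (continuousOn_const.mul continuousOn_id) :
      ContinuousOn (fun x => A x - c' * x) (Icc 0 1))
  have hmaj : ∀ x ∈ Icc (0:ℝ) 1, F x ≤ c' * x + (A z - c' * z) := by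
    refine hleast _ ⟨convex_Icc 0 1, fun p _ q _ u v _ _ huv => le_of_eq ?_⟩ fun x hx => ?_
    · simp only [smul_eq_mul]
      linear_combination (A z - c' * z) * huv
    · have := hzmax hx
      change A x - c' * x ≤ A z - c' * z at this
      linarith
  have hFz : F z = A z := le_antisymm (by linarith [hmaj z hz]) (hge z hz)
  have hsz : s ≤ z := by
    by_contra! hzs
    obtain ⟨w, hw1, hw2⟩ := exists_between hzs
    have hw : w ∈ Ioc (0:ℝ) 1 := ⟨by linarith [hz.1], by linarith [hs.2]⟩
    have h1 := hsup w hw z hz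
    have h2 := hmaj w ⟨hw.1.le, hw.2⟩
    have h3 := hlt w ⟨hw.1, hw2⟩
    nlinarith
  have hzy : z ≤ y := by
    by_contra! hyz
    obtain ⟨hyI, h⟩ := hy z hz hyz
    linarith [hmaj y hyI]
  refine hnz (y := z) ?_ hz (sub_eq_zero.mpr hFz)
  rw [Real.dist_eq, abs_of_nonneg (by linarith)]
  linarith

/-- The lower Lebesgue integral of a nonnegative integrable function over `(0, s]`. -/
lemma setLIntegral_Ioc_ofReal {f : ℝ → ℝ} {s : ℝ} (hs : s ∈ Icc (0:ℝ) 1)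
    (hf : IntegrableOn f (Ioc 0 1)) (hf0 : ∀ x ∈ Ioc (0:ℝ) 1, 0 ≤ f x) :
    ∫⁻ x in Ioc 0 s, ENNReal.ofReal (f x) = ENNReal.ofReal (∫ x in (0:ℝ)..s, f x) := by
  rw [intervalIntegral.integral_of_le hs.1,
    ofReal_integral_eq_lintegral_ofReal (hf.mono_set (Ioc_subset_Ioc_right hs.2))]
  exact ae_restrict_of_forall_mem measurableSet_Ioc fun x hx => hf0 x ⟨hx.1, hx.2.trans hs.2⟩

/-- An up-set for an antitone function on `(0, t]` is an initial interval up to a null set. -/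
lemma AntitoneOn.exists_superlevel_ae_eq_Ioc {f : ℝ → ℝ} {t c : ℝ} (ht : t ∈ Ioc (0:ℝ) 1)
    (hf : AntitoneOn f (Ioc 0 1)) (hc : f t < c) :
    ∃ s ∈ Icc 0 t, (Ioc 0 t ∩ f ⁻¹' Ici c : Set ℝ) =ᵐ[volume] Ioc 0 s ∧
      (∀ y ∈ Ioo 0 s, c ≤ f y) ∧ ∀ y ∈ Ioc s 1, f y < c := by
  set S : Set ℝ := Ioc 0 t ∩ f ⁻¹' Ici c
  have hbdd : BddAbove (insert 0 S) :=
    ⟨t, by rintro x (rfl | hx); exacts [ht.1.le, hx.1.2]⟩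
  have h0 : 0 ≤ sSup (insert 0 S) := le_csSup hbdd (mem_insert _ _)
  have hlt : ∀ y ∈ Ioo 0 (sSup (insert 0 S)), y ∈ S := by
    intro y hy
    obtain ⟨x, hx, hyx⟩ := exists_lt_of_lt_csSup (insert_nonempty _ _) hy.2
    rcases hx with rfl | hx
    · exact absurd hyx hy.1.not_gt
    · have hyt : y ≤ t := hyx.le.trans hx.1.2
      exact ⟨⟨hy.1, hyt⟩, le_trans (mem_Ici.mp hx.2)
        (hf ⟨hy.1, hyt.trans ht.2⟩ ⟨hx.1.1, hx.1.2.trans ht.2⟩ hyx.le)⟩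
  have hle : S ⊆ Ioc 0 (sSup (insert 0 S)) :=
    fun x hx => ⟨hx.1.1, le_csSup hbdd (mem_insert_of_mem _ hx)⟩
  refine ⟨sSup (insert 0 S), ⟨h0, csSup_le (insert_nonempty _ _) ?_⟩, ?_,
    fun y hy => (hlt y hy).2, fun y hy => ?_⟩
  · rintro x (rfl | hx)
    exacts [ht.1.le, hx.1.2]
  · exact Filter.EventuallyLE.antisymm (LE.le.eventuallyLE hle)
      (Ioo_ae_eq_Ioc.symm.le.trans (LE.le.eventuallyLE hlt))
  · by_contra! hcy
    rcases le_or_gt y t with hyt | hyt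
    · exact (hle ⟨⟨h0.trans_lt hy.1, hyt⟩, hcy⟩).2.not_gt hy.1
    · linarith [hf ht ⟨h0.trans_lt hy.1, hy.2⟩ hyt.le]

/-- Since `g` is nonnegative, the identity of Lemma `flip` is stated using (lower) Lebesgue
integrals, so that no integrability assumption on `g ∘ â` is needed. -/
theorem stmt8 (a A Ahat ahat : ℝ → ℝ)
    -- `a : [0,1] → [0,∞)` is Riemann integrable and `A(t) = ∫₀ᵗ a(s) ds`, `A(1) = 1`
    (ha_nonneg : ∀ s ∈ Set.Icc (0:ℝ) 1, 0 ≤ a s)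
    (ha_int : RiemannIntegrableOn01 a)
    (hA : ∀ t ∈ Set.Icc (0:ℝ) 1, A t = ∫ s in (0:ℝ)..t, a s)
    (hA1 : A 1 = 1)
    -- `Â` is the least concave majorant of `A` on `[0,1]`
    (hAhat_conc : ConcaveOn ℝ (Set.Icc 0 1) Ahat)
    (hAhat_ge : ∀ t ∈ Set.Icc (0:ℝ) 1, A t ≤ Ahat t)
    (hAhat_least : ∀ g : ℝ → ℝ, ConcaveOn ℝ (Set.Icc 0 1) g →
      (∀ t ∈ Set.Icc (0:ℝ) 1, A t ≤ g t) → ∀ t ∈ Set.Icc (0:ℝ) 1, Ahat t ≤ g t)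
    -- `â` is the left-derivative of `Â`, a nonincreasing nonnegative function
    (hahat_deriv : ∀ t ∈ Set.Ioc (0:ℝ) 1, HasDerivWithinAt Ahat (ahat t) (Set.Iic t) t)
    (hahat_nonneg : ∀ t ∈ Set.Ioc (0:ℝ) 1, 0 ≤ ahat t)
    (hahat_anti : AntitoneOn ahat (Set.Ioc 0 1))
    -- `g : [0,∞) → [0,∞)` is measurable
    (g : ℝ → ℝ) (hg : Measurable g) (hg_nonneg : ∀ y, 0 ≤ y → 0 ≤ g y)
    (t : ℝ) (ht : t ∈ Set.Ioc (0:ℝ) 1) :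
    (∫⁻ x in Set.Ioc (0:ℝ) t, ENNReal.ofReal (g (ahat x) * a x)) +
        ENNReal.ofReal (g (ahat t) * (Ahat t - A t)) =
      ∫⁻ x in Set.Ioc (0:ℝ) t, ENNReal.ofReal (g (ahat x) * ahat x) := by
  obtain ⟨ha, -, C, hC⟩ := ha_int
  have ha' : IntegrableOn a (Ioc 0 1) := ha.mono_set Ioc_subset_Icc_self
  have hAt : ∀ x ∈ Icc (0:ℝ) 1, A x ≤ C * x := by
    intro x hx
    rw [hA x hx]
    have h := intervalIntegral.integral_mono_on (f := a) (g := fun _ => C) (μ := volume) hx.1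
      ((intervalIntegrable_iff_integrableOn_Ioc_of_le hx.1).mpr
        (ha'.mono_set (Ioc_subset_Ioc_right hx.2))) (by simp)
      fun y hy => (le_abs_self _).trans (hC y ⟨hy.1, hy.2.trans hx.2⟩)
    simp only [intervalIntegral.integral_const, sub_zero, smul_eq_mul] at h
    linarith
  have hFC : ∀ x ∈ Icc (0:ℝ) 1, Ahat x ≤ C * x := by
    refine hAhat_least _ ⟨convex_Icc 0 1, fun p _ q _ u v _ _ _ => le_of_eq ?_⟩ hAt
    simp only [smul_eq_mul]
    ring
  have h0I : (0:ℝ) ∈ Icc (0:ℝ) 1 := left_mem_Icc.mpr zero_le_one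
  have hA0 : A 0 = 0 := by simpa using hA 0 h0I
  have hF0 : Ahat 0 = 0 :=
    le_antisymm (by simpa using hFC 0 h0I) (by simpa [hA0] using hAhat_ge 0 h0I)
  have hsup : ∀ y ∈ Ioc (0:ℝ) 1, ∀ x ∈ Icc (0:ℝ) 1, Ahat x ≤ Ahat y + ahat y * (x - y) :=
    fun y hy x hx => hAhat_conc.le_add_mul_sub_of_hasDerivWithinAt_Iic hx ⟨hy.1.le, hy.2⟩ h0I hy.1
      (hahat_deriv y hy)
  have hleC : ∀ y ∈ Ioc (0:ℝ) 1, ahat y ≤ C := by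
    intro y hy
    have h1 := hsup y hy 0 h0I
    have h2 := hFC y ⟨hy.1.le, hy.2⟩
    refine le_of_mul_le_mul_right ?_ hy.1
    linarith
  have hFc : ContinuousOn Ahat (Icc 0 1) := by
    have hC0 : 0 ≤ C := (abs_nonneg _).trans (hC 0 h0I)
    have hlip : ∀ u ∈ Icc (0:ℝ) 1, ∀ v ∈ Icc (0:ℝ) 1, u ≤ v → |Ahat u - Ahat v| ≤ C * (v - u) := by
      intro u hu v hv huv
      have hup : Ahat v - Ahat u ≤ C * (v - u) := by
        rcases hu.1.eq_or_lt with rfl | h0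
        · simpa [hF0] using hFC v hv
        · have h1 := hsup u ⟨h0, hu.2⟩ v hv
          nlinarith [hleC u ⟨h0, hu.2⟩]
      have hlo : Ahat u ≤ Ahat v := by
        rcases huv.eq_or_lt with rfl | h
        · rfl
        · have hv' : v ∈ Ioc (0:ℝ) 1 := ⟨hu.1.trans_lt h, hv.2⟩
          nlinarith [hsup v hv' u hu, hahat_nonneg v hv']
      rw [abs_sub_comm, abs_of_nonneg (by linarith)]
      exact hup
    refine (LipschitzOnWith.of_dist_le_mul (K := ⟨C, hC0⟩) fun u hu v hv => ?_).continuousOn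
    rw [Real.dist_eq, Real.dist_eq]
    rcases le_total u v with h | h
    · rw [abs_sub_comm u v, abs_of_nonneg (sub_nonneg.mpr h)]
      exact hlip u hu v hv h
    · rw [abs_sub_comm (Ahat u), abs_of_nonneg (sub_nonneg.mpr h)]
      exact hlip v hv u hu h
  have hAc : ContinuousOn A (Icc 0 1) := by
    have := intervalIntegral.continuousOn_primitive_interval (f := a) (a := 0) (b := 1)
      (μ := volume) (by rwa [uIcc_of_le zero_le_one])
    rw [uIcc_of_le zero_le_one] at this
    exact this.congr hA
  have hahat_meas : AEMeasurable ahat (volume.restrict (Ioc 0 1)) :=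
    aemeasurable_restrict_of_antitoneOn measurableSet_Ioc hahat_anti
  have hahat_int : IntegrableOn ahat (Ioc 0 1) := by
    refine Integrable.of_bound hahat_meas.aestronglyMeasurable C
      (ae_restrict_of_forall_mem measurableSet_Ioc fun x hx => ?_)
    rw [Real.norm_of_nonneg (hahat_nonneg x hx)]
    exact hleC x hx
  have hlA : ∀ s ∈ Icc (0:ℝ) 1, ∫⁻ x in Ioc 0 s, ENNReal.ofReal (a x) = ENNReal.ofReal (A s) :=
    fun s hs => by
      rw [setLIntegral_Ioc_ofReal hs ha' fun x hx => ha_nonneg x ⟨hx.1.le, hx.2⟩, hA s hs]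
  have hlF : ∀ s ∈ Icc (0:ℝ) 1,
      ∫⁻ x in Ioc 0 s, ENNReal.ofReal (ahat x) = ENNReal.ofReal (Ahat s) := by
    intro s hs
    rw [setLIntegral_Ioc_ofReal hs hahat_int hahat_nonneg,
      integral_eq_sub_of_hasDeriv_left_of_le hs.1 (hFc.mono (Icc_subset_Icc_right hs.2))
        (fun x hx => (hahat_deriv x ⟨hx.1, hx.2.le.trans hs.2⟩).mono Iio_subset_Iic_self)
        ((intervalIntegrable_iff_integrableOn_Ioc_of_le hs.1).mpr
        (hahat_int.mono_set (Ioc_subset_Ioc_right hs.2))), hF0, sub_zero]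
  have htI : t ∈ Icc (0:ℝ) 1 := ⟨ht.1.le, ht.2⟩
  have hA_nonneg : 0 ≤ A t := by
    rw [hA t htI]
    exact intervalIntegral.integral_nonneg ht.1.le fun x hx => ha_nonneg x ⟨hx.1, hx.2.trans ht.2⟩
  have hμt : volume.restrict (Ioc 0 t) ≤ volume.restrict (Ioc (0:ℝ) 1) :=
    Measure.restrict_mono_set _ (Ioc_subset_Ioc_right ht.2)
  have hm := hahat_meas.mono_measure hμt
  have hma : AEMeasurable (fun x => ENNReal.ofReal (a x)) (volume.restrict (Ioc 0 t)) :=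
    (ha'.aemeasurable.mono_measure hμt).ennreal_ofReal
  have hmF : AEMeasurable (fun x => ENNReal.ofReal (ahat x)) (volume.restrict (Ioc 0 t)) :=
    hm.ennreal_ofReal
  set μ := (volume.restrict (Ioc 0 t)).withDensity fun x => ENNReal.ofReal (a x) with hμ
  set ν := (volume.restrict (Ioc 0 t)).withDensity fun x => ENNReal.ofReal (ahat x) with hν
  have hmμ : AEMeasurable ahat μ := hm.mono_ac (withDensity_absolutelyContinuous _ _)
  have hmν : AEMeasurable ahat ν := hm.mono_ac (withDensity_absolutelyContinuous _ _)
  have : IsFiniteMeasure ν := isFiniteMeasure_withDensity (by rw [hlF t htI]; simp)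
  have heq : ν.map ahat =
      μ.map ahat + ENNReal.ofReal (Ahat t - A t) • Measure.dirac (ahat t) := by
    refine Measure.ext_of_Ici _ _ fun c => ?_
    have hrestr : ∀ u : ℝ → ENNReal, (volume.restrict (Ioc 0 t)).withDensity u (ahat ⁻¹' Ici c) =
        ∫⁻ x in Ioc 0 t ∩ ahat ⁻¹' Ici c, u x := by
      intro u
      have hnull : NullMeasurableSet (ahat ⁻¹' Ici c) (volume.restrict (Ioc 0 t)) :=
        hm.nullMeasurableSet_preimage measurableSet_Ici
      rw [withDensity_apply₀ _ hnull, Measure.restrict_restrict₀ hnull, inter_comm]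
    rw [Measure.map_apply_of_aemeasurable hmν measurableSet_Ici, Measure.add_apply,
      Measure.map_apply_of_aemeasurable hmμ measurableSet_Ici, Measure.smul_apply,
      Measure.dirac_apply' _ measurableSet_Ici, hμ, hν, hrestr, hrestr]
    rcases le_or_gt c (ahat t) with hc | hc
    · have hS : Ioc 0 t ∩ ahat ⁻¹' Ici c = Ioc 0 t := inter_eq_left.mpr fun x hx =>
        hc.trans (hahat_anti ⟨hx.1, hx.2.trans ht.2⟩ ht hx.2)
      rw [hS, hlF t htI, hlA t htI, indicator_of_mem (mem_Ici.mpr hc), Pi.one_apply, smul_eq_mul,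
        mul_one, ← ENNReal.ofReal_add hA_nonneg (sub_nonneg.mpr (hAhat_ge t htI))]
      congr 1
      ring
    · obtain ⟨s, hs, hae, hlt, hgt⟩ := hahat_anti.exists_superlevel_ae_eq_Ioc ht hc
      have hsI : s ∈ Icc (0:ℝ) 1 := ⟨hs.1, hs.2.trans ht.2⟩
      rw [setLIntegral_congr hae, setLIntegral_congr hae, hlF s hsI, hlA s hsI,
        eq_of_least_concave_majorant hAc hFc hAhat_ge hAhat_least hsup hsI hlt hgt,
        indicator_of_notMem (by simpa using hc), smul_zero, add_zero]
  have hG : Measurable fun y => ENNReal.ofReal (g y) := hg.ennreal_ofReal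
  have hGm : AEMeasurable (fun x => ENNReal.ofReal (g (ahat x))) (volume.restrict (Ioc 0 t)) :=
    hG.comp_aemeasurable hm
  have hkey := congrArg (fun κ => ∫⁻ y, ENNReal.ofReal (g y) ∂κ) heq
  simp only [lintegral_add_measure, lintegral_smul_measure, lintegral_dirac' _ hG] at hkey
  rw [lintegral_map' hG.aemeasurable hmν, lintegral_map' hG.aemeasurable hmμ, hμ, hν,
    lintegral_withDensity_eq_lintegral_mul₀ hma hGm,
    lintegral_withDensity_eq_lintegral_mul₀ hmF hGm] at hkey
  have hmul : ∀ u : ℝ → ℝ, ∫⁻ x in Ioc 0 t, ENNReal.ofReal (g (ahat x) * u x) =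
      ∫⁻ x in Ioc 0 t, ((fun x => ENNReal.ofReal (u x)) *
        fun x => ENNReal.ofReal (g (ahat x))) x := by
    refine fun u => setLIntegral_congr_fun measurableSet_Ioc fun x hx => ?_
    simp only [Pi.mul_apply]
    rw [ENNReal.ofReal_mul (hg_nonneg _ (hahat_nonneg x ⟨hx.1, hx.2.trans ht.2⟩)), mul_comm]
  rw [hmul, hmul, hkey, ENNReal.ofReal_mul (hg_nonneg _ (hahat_nonneg t ht)), smul_eq_mul,
    mul_comm (ENNReal.ofReal (g (ahat t)))]
end

section
/- For every t ∈ [0,1] with â(t) > 0, ∫₀ᵗ v(s)²/(2a(s)) ds = (log 2)·(t − (Â(t) − A(t))/â(t)); consequently E(v,t) ≤ 0 for all t ∈ [0,1], i.e. v ∈ R. -/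
open MeasureTheory Set Filter

/-- The energy functional: `Ecost a b t` is `∫₀ᵗ b(s)²/(2a(s)) ds`, valued in `[0,∞]`,
with the conventions `0/0 = 0` and `c/0 = ∞` for `c ≠ 0`.
The condition `E(b,t) ≤ 0` of the paper, i.e. `-(log 2)·t + ∫₀ᵗ b(s)²/(2a(s)) ds ≤ 0`,
then reads `Ecost a b t ≤ ENNReal.ofReal (Real.log 2 * t)`. -/
noncomputable def Ecost (a b : ℝ → ℝ) (t : ℝ) : ENNReal :=
  ∫⁻ s in Set.Ioc (0:ℝ) t,
    (if a s = 0 then (if b s = 0 then 0 else ⊤) else ENNReal.ofReal (b s ^ 2 / (2 * a s)))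

/-- Membership in the class `R` of measurable functions `b : [0,1] → ℝ` with
`E(b,t) ≤ 0` for all `t ∈ [0,1]`. -/
def memR (a b : ℝ → ℝ) : Prop :=
  AEMeasurable b (volume.restrict (Set.Icc (0:ℝ) 1)) ∧
  ∀ t ∈ Set.Icc (0:ℝ) 1, Ecost a b t ≤ ENNReal.ofReal (Real.log 2 * t)

/-- `v(s) = a(s)·√(2 log 2 / â(s))` when `â(s) > 0`, and `v(s) = 0` otherwise. -/
noncomputable def vfun (a ahat : ℝ → ℝ) (s : ℝ) : ℝ :=
  if 0 < ahat s then a s * Real.sqrt (2 * Real.log 2 / ahat s) else 0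

theorem eq_of_abs_sub_le_mul_sub {G m : ℝ → ℝ} {t K : ℝ} (ht : 0 ≤ t)
    (h : ∀ x y, 0 ≤ x → x ≤ y → y ≤ t → |G y - G x| ≤ K * (y - x) * (m y - m x)) :
    G t = G 0 := by
  have key : ∀ n : ℕ, |G t - G 0| ≤ K * t * (m t - m 0) / ((n : ℝ) + 1) := by
    intro n
    have hn : (0 : ℝ) < (n : ℝ) + 1 := by positivity
    let p : ℕ → ℝ := fun i => i * (t / (n + 1))
    have hp0 : p 0 = 0 := by simp [p]
    have hpt : p (n + 1) = t := by simp only [p]; push_cast; field_simp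
    have hstep : ∀ i, p (i + 1) - p i = t / (n + 1) := by
      intro i; simp only [p]; push_cast; ring
    have hG := Finset.sum_range_sub (fun i => G (p i)) (n + 1)
    have hm := Finset.sum_range_sub (fun i => m (p i)) (n + 1)
    simp only [hp0, hpt] at hG hm
    rw [← hG]
    calc |∑ i ∈ Finset.range (n + 1), (G (p (i + 1)) - G (p i))|
        ≤ ∑ i ∈ Finset.range (n + 1), |G (p (i + 1)) - G (p i)| :=
          Finset.abs_sum_le_sum_abs _ _
      _ ≤ ∑ i ∈ Finset.range (n + 1), K * (t / (n + 1)) * (m (p (i + 1)) - m (p i)) := by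
          refine Finset.sum_le_sum fun i hi => ?_
          have hd : 0 ≤ t / ((n : ℝ) + 1) := by positivity
          have hi' : ((i + 1 : ℕ) : ℝ) ≤ ((n + 1 : ℕ) : ℝ) := by
            exact_mod_cast Finset.mem_range.1 hi
          have h1 : p (i + 1) ≤ t := by
            rw [← hpt]; exact mul_le_mul_of_nonneg_right hi' hd
          have h2 : p i ≤ p (i + 1) := by linarith [hstep i]
          have h3 : 0 ≤ p i := by simp only [p]; positivity
          have := h _ _ h3 h2 h1
          rwa [hstep] at this
      _ = K * t * (m t - m 0) / ((n : ℝ) + 1) := by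
          rw [← Finset.mul_sum, hm]; ring
  have hlim : Tendsto (fun n : ℕ => K * t * (m t - m 0) / ((n : ℝ) + 1)) atTop (nhds 0) := by
    have := (tendsto_const_div_atTop_nhds_zero_nat (K * t * (m t - m 0))).comp
      (tendsto_add_atTop_nat 1)
    simpa [Function.comp_def] using this
  have h0 : |G t - G 0| ≤ 0 := ge_of_tendsto' hlim key
  exact sub_eq_zero.1 (abs_eq_zero.1 (le_antisymm h0 (abs_nonneg _)))

theorem ConcaveOn.sub_le_mul_of_hasDerivWithinAt_Iic {f : ℝ → ℝ} {d a b x y : ℝ}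
    (hf : ConcaveOn ℝ (Icc a b) f) (hax : a < x) (hxy : x ≤ y) (hyb : y ≤ b)
    (hd : HasDerivWithinAt f d (Iic x) x) : f y - f x ≤ d * (y - x) := by
  rcases hxy.eq_or_lt with rfl | hxy
  · simp
  have hs := hasDerivWithinAt_iff_tendsto_slope.1 hd
  rw [Iic_sdiff_right] at hs
  have hle : (f y - f x) / (y - x) ≤ d := by
    refine ge_of_tendsto hs ?_
    filter_upwards [Ioo_mem_nhdsLT hax] with w hw
    have := hf.slope_anti_adjacent (x := w) (y := x) (z := y)
      ⟨hw.1.le, by linarith [hw.2]⟩ ⟨by linarith, hyb⟩ hw.2 hxy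
    rwa [slope_comm, slope_def_field]
  rwa [div_le_iff₀ (by linarith)] at hle

theorem ConcaveOn.mul_le_sub_of_hasDerivWithinAt_Iic {f : ℝ → ℝ} {d a b x y : ℝ}
    (hf : ConcaveOn ℝ (Icc a b) f) (hax : a ≤ x) (hxy : x ≤ y) (hyb : y ≤ b)
    (hd : HasDerivWithinAt f d (Iic y) y) : d * (y - x) ≤ f y - f x := by
  rcases hxy.eq_or_lt with rfl | hxy
  · simp
  have hle := hf.le_slope_of_hasDerivWithinAt_Iio ⟨hax, by linarith⟩ ⟨by linarith, hyb⟩ hxy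
    (hd.mono Iio_subset_Iic_self)
  rwa [slope_def_field, le_div_iff₀ (by linarith)] at hle

/-- Where a least concave majorant lies strictly above the function, it is locally affine. -/
theorem exists_affine_of_lt_least_concave {A H : ℝ → ℝ} {C p : ℝ} (hC : 0 < C)
    (hconc : ConcaveOn ℝ (Icc 0 1) H)
    (hge : ∀ t ∈ Icc (0 : ℝ) 1, A t ≤ H t)
    (hleast : ∀ g : ℝ → ℝ, ConcaveOn ℝ (Icc 0 1) g →
      (∀ t ∈ Icc (0 : ℝ) 1, A t ≤ g t) → ∀ t ∈ Icc (0 : ℝ) 1, H t ≤ g t)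
    (hAmono : MonotoneOn A (Icc 0 1)) (hHmono : MonotoneOn H (Icc 0 1))
    (hAlip : ∀ x y, 0 ≤ x → x ≤ y → y ≤ 1 → A y - A x ≤ C * (y - x))
    (hHlip : ∀ x y, 0 ≤ x → x ≤ y → y ≤ 1 → H y - H x ≤ C * (y - x))
    (hp : p ∈ Ioo (0 : ℝ) 1) (hlt : A p < H p) :
    ∃ x y m, 0 ≤ x ∧ x < p ∧ p < y ∧ y ≤ 1 ∧
      ∀ z ∈ Icc x y, H z = H x + m * (z - x) := by
  obtain ⟨δ, hδ0, hδ1, hδ2, hδ3⟩ : ∃ δ > 0, δ ≤ p ∧ δ ≤ 1 - p ∧ 2 * (C * δ) ≤ H p - A p := by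
    refine ⟨min (min p (1 - p)) ((H p - A p) / (2 * C)), ?_, ?_, ?_, ?_⟩
    · exact lt_min (lt_min hp.1 (by linarith [hp.2])) (div_pos (by linarith) (by linarith))
    · exact (min_le_left _ _).trans (min_le_left _ _)
    · exact (min_le_left _ _).trans (min_le_right _ _)
    · have := min_le_right (min p (1 - p)) ((H p - A p) / (2 * C))
      rw [le_div_iff₀ (by linarith)] at this
      linarith
  obtain ⟨x, hx⟩ : ∃ x, x = p - δ := ⟨_, rfl⟩
  obtain ⟨y, hy⟩ : ∃ y, y = p + δ := ⟨_, rfl⟩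
  have hx0 : 0 ≤ x := by linarith
  have hy1 : y ≤ 1 := by linarith
  have hxy : x < y := by linarith
  have hxm : x ∈ Icc (0 : ℝ) 1 := ⟨hx0, by linarith⟩
  have hym : y ∈ Icc (0 : ℝ) 1 := ⟨by linarith, hy1⟩
  have hpm : p ∈ Icc (0 : ℝ) 1 := ⟨hp.1.le, hp.2.le⟩
  obtain ⟨m, hm⟩ : ∃ m, m = (H y - H x) / (y - x) := ⟨_, rfl⟩
  have hm0 : 0 ≤ m := by
    rw [hm]; exact div_nonneg (sub_nonneg.2 (hHmono hxm hym hxy.le)) (by linarith)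
  have hHy : H y = H x + m * (y - x) := by
    rw [hm, div_mul_cancel₀ _ (by linarith)]; ring
  have hLconc : ConcaveOn ℝ (Icc (0 : ℝ) 1) (fun z => H x + m * (z - x)) := by
    refine ⟨convex_Icc _ _, fun u _ w _ c d _ _ hcd => le_of_eq ?_⟩
    simp only [smul_eq_mul]
    linear_combination (H x - m * x) * hcd
  have hAL : ∀ z ∈ Icc (0 : ℝ) 1, A z ≤ H x + m * (z - x) := by
    intro z hz
    rcases lt_or_ge z x with hzx | hzx
    · have := hconc.slope_anti_adjacent hz hym hzx hxy
      rw [← hm, le_div_iff₀ (by linarith)] at this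
      linarith [hge z hz]
    rcases lt_or_ge y z with hyz | hyz
    · have := hconc.slope_anti_adjacent hxm hz hxy hyz
      rw [← hm, div_le_iff₀ (by linarith)] at this
      linarith [hge z hz]
    · have h1 : A z ≤ A y := hAmono hz hym hyz
      have h2 := hAlip p y hp.1.le (by linarith) hy1
      have h3 := hHlip x p hx0 (by linarith) hp.2.le
      have h4 : y - p = δ := by linarith
      have h5 : p - x = δ := by linarith
      rw [h4] at h2
      rw [h5] at h3
      have h6 : 0 ≤ m * (z - x) := mul_nonneg hm0 (by linarith)
      linarith
  refine ⟨x, y, m, hx0, by linarith, by linarith, hy1, fun z hz => le_antisymm ?_ ?_⟩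
  · exact hleast _ hLconc hAL z ⟨by linarith [hz.1], by linarith [hz.2]⟩
  · rcases hz.1.eq_or_lt with rfl | hxz
    · simp
    rcases hz.2.eq_or_lt with rfl | hzy
    · exact hHy.ge
    have := hconc.slope_anti_adjacent hxm hym hxz hzy
    have h1 : 0 < z - x := by linarith
    have h2 : 0 < y - z := by linarith
    rw [div_le_div_iff₀ h2 h1, hHy] at this
    have h3 : 0 ≤ (y - x) * (H z - H x - m * (z - x)) := by nlinarith
    linarith [nonneg_of_mul_nonneg_right h3 (by linarith)]

theorem integral_mul_inv_eq {a A H α : ℝ → ℝ} {C t : ℝ}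
    (ha0 : ∀ s ∈ Icc (0 : ℝ) 1, 0 ≤ a s)
    (hai : IntegrableOn a (Icc 0 1) volume)
    (hA : ∀ t ∈ Icc (0 : ℝ) 1, A t = ∫ s in (0 : ℝ)..t, a s)
    (hAlip : ∀ x y, 0 ≤ x → x ≤ y → y ≤ 1 → A y - A x ≤ C * (y - x))
    (hge : ∀ t ∈ Icc (0 : ℝ) 1, A t ≤ H t)
    (hα : AntitoneOn α (Icc 0 1)) (hα0 : ∀ s ∈ Icc (0 : ℝ) 1, 0 ≤ α s)
    (hαC : ∀ s ∈ Icc (0 : ℝ) 1, α s ≤ C)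
    (hlow : ∀ x y, 0 ≤ x → x ≤ y → y ≤ 1 → α y * (y - x) ≤ H y - H x)
    (hup : ∀ x y, 0 ≤ x → x ≤ y → y ≤ 1 → H y - H x ≤ α x * (y - x))
    (hH0 : H 0 = 0)
    (hflat : ∀ x y, 0 ≤ x → x ≤ y → y ≤ 1 → α y < α x → ∃ z ∈ Icc x y, A z = H z)
    (ht : t ∈ Icc (0 : ℝ) 1) (hαt : 0 < α t) :
    IntegrableOn (fun s => a s * (α s)⁻¹) (Ioc 0 t) volume ∧
    ∫ s in (0 : ℝ)..t, a s * (α s)⁻¹ = t - (H t - A t) / α t := by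
  have hsub : Icc (0 : ℝ) t ⊆ Icc 0 1 := Icc_subset_Icc_right ht.2
  have hpos : ∀ s ∈ Icc (0 : ℝ) t, 0 < α s := fun s hs =>
    hαt.trans_le (hα (hsub hs) ht hs.2)
  have hφ : MonotoneOn (fun s => (α s)⁻¹) (Icc 0 t) := fun u hu w hw huw =>
    inv_anti₀ (hpos w hw) (hα (hsub hu) (hsub hw) huw)
  have hint : IntegrableOn (fun s => a s * (α s)⁻¹) (Icc 0 t) volume := by
    refine Integrable.mul_bdd (c := (α t)⁻¹) (hai.mono_set hsub)
      (aemeasurable_restrict_of_monotoneOn measurableSet_Icc hφ).aestronglyMeasurable ?_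
    filter_upwards [ae_restrict_mem measurableSet_Icc] with s hs
    rw [Real.norm_of_nonneg (inv_nonneg.2 (hpos s hs).le)]
    exact hφ hs ⟨ht.1, le_rfl⟩ hs.2
  refine ⟨hint.mono_set Ioc_subset_Icc_self, ?_⟩
  have hai' : ∀ x y, 0 ≤ x → x ≤ y → y ≤ t → IntervalIntegrable a volume x y :=
    fun x y hx hxy hy => (intervalIntegrable_iff_integrableOn_Icc_of_le hxy).2
      (hai.mono_set (Icc_subset_Icc hx (hy.trans ht.2)))
  have hint' : ∀ x y, 0 ≤ x → x ≤ y → y ≤ t →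
      IntervalIntegrable (fun s => a s * (α s)⁻¹) volume x y :=
    fun x y hx hxy hy => (intervalIntegrable_iff_integrableOn_Icc_of_le hxy).2
      (hint.mono_set (Icc_subset_Icc hx hy))
  have key := eq_of_abs_sub_le_mul_sub (K := 2 * C) (m := fun s => (α s)⁻¹)
    (G := fun y => (α y)⁻¹ * (H y - A y) - y + ∫ s in (0 : ℝ)..y, a s * (α s)⁻¹) ht.1 ?_
  · have hA0 : A 0 = 0 := by simpa using hA 0 (by simp)
    simp only [hH0, hA0, intervalIntegral.integral_same] at key
    rw [div_eq_inv_mul]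
    linarith
  intro x y hx hxy hy
  have hxm : x ∈ Icc (0 : ℝ) t := ⟨hx, by linarith⟩
  have hym : y ∈ Icc (0 : ℝ) t := ⟨by linarith, hy⟩
  have hAsub : ∫ s in x..y, a s = A y - A x := by
    rw [hA y (hsub hym), hA x (hsub hxm)]
    exact (intervalIntegral.integral_interval_sub_left (hai' 0 y le_rfl hym.1 hy)
      (hai' 0 x le_rfl hx hxm.2)).symm
  have hIsub := intervalIntegral.integral_interval_sub_left (hint' 0 y le_rfl hym.1 hy)
      (hint' 0 x le_rfl hx hxm.2)
  have hI1 : ∫ s in x..y, a s * (α s)⁻¹ ≤ (A y - A x) * (α y)⁻¹ := by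
    rw [← hAsub, ← intervalIntegral.integral_mul_const]
    refine intervalIntegral.integral_mono_on hxy (hint' x y hx hxy hy)
      ((hai' x y hx hxy hy).mul_const _) fun s hs => ?_
    have hs' : s ∈ Icc (0 : ℝ) t := ⟨hx.trans hs.1, hs.2.trans hy⟩
    exact mul_le_mul_of_nonneg_left (hφ hs' hym hs.2) (ha0 s (hsub hs'))
  have hI2 : (A y - A x) * (α x)⁻¹ ≤ ∫ s in x..y, a s * (α s)⁻¹ := by
    rw [← hAsub, ← intervalIntegral.integral_mul_const]
    refine intervalIntegral.integral_mono_on hxy ((hai' x y hx hxy hy).mul_const _)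
      (hint' x y hx hxy hy) fun s hs => ?_
    have hs' : s ∈ Icc (0 : ℝ) t := ⟨hx.trans hs.1, hs.2.trans hy⟩
    exact mul_le_mul_of_nonneg_left (hφ hxm hs' hs.1) (ha0 s (hsub hs'))
  rw [← hIsub] at hI1 hI2
  have hy1 := hy.trans ht.2
  have hΔ : 0 ≤ (α y)⁻¹ - (α x)⁻¹ := sub_nonneg.2 (hφ hxm hym hxy)
  have hyx : 0 ≤ y - x := by linarith
  have hαy := hpos y hym
  have hαx := hpos x hxm
  have hB1 : y - x ≤ (α y)⁻¹ * (H y - H x) := by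
    rw [inv_mul_eq_div, le_div_iff₀ hαy]
    linarith [hlow x y hx hxy hy1]
  have hB2 : (α y)⁻¹ * (H y - H x) - (y - x) ≤ C * (y - x) * ((α y)⁻¹ - (α x)⁻¹) := by
    have h1 := mul_le_mul_of_nonneg_left (hup x y hx hxy hy1) (inv_pos.2 hαy).le
    have h2 := mul_le_mul_of_nonneg_right (hαC x (hsub hxm)) (mul_nonneg hyx hΔ)
    have h3 : α x * ((y - x) * ((α y)⁻¹ - (α x)⁻¹)) = (α y)⁻¹ * (α x * (y - x)) - (y - x) := by
      field_simp
    linarith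
  have hAl := mul_le_mul_of_nonneg_right (hAlip x y hx hxy hy1) hΔ
  have hD0 : 0 ≤ (H x - A x) * ((α y)⁻¹ - (α x)⁻¹) :=
    mul_nonneg (sub_nonneg.2 (hge x (hsub hxm))) hΔ
  have hD : (H x - A x) * ((α y)⁻¹ - (α x)⁻¹) ≤ C * (y - x) * ((α y)⁻¹ - (α x)⁻¹) := by
    rcases (hα (hsub hxm) (hsub hym) hxy).eq_or_lt with heq | hlt
    · simp [heq]
    · refine mul_le_mul_of_nonneg_right ?_ hΔ
      obtain ⟨z, hz, hAz⟩ := hflat x y hx hxy hy1 hlt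
      have h1 := hAlip x z hx hz.1 (hz.2.trans hy1)
      have hzm : z ∈ Icc (0 : ℝ) 1 := ⟨hx.trans hz.1, hz.2.trans hy1⟩
      have h2 := hlow x z hx hz.1 hzm.2
      have h3 := mul_nonneg (hα0 z hzm) (sub_nonneg.2 hz.1)
      have hC : 0 ≤ C := (hα0 z hzm).trans (hαC z hzm)
      have h4 := mul_le_mul_of_nonneg_left (sub_le_sub_right hz.2 x) hC
      linarith
  rw [abs_le]
  constructor <;> linarith

theorem eq_left_of_locally_affine {H α : ℝ → ℝ} {x y : ℝ} (hxy : x ≤ y)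
    (hlow : ∀ x y, 0 ≤ x → x ≤ y → y ≤ 1 → α y * (y - x) ≤ H y - H x)
    (hup : ∀ x y, 0 ≤ x → x ≤ y → y ≤ 1 → H y - H x ≤ α x * (y - x))
    (haff : ∀ p ∈ Icc x y, ∃ u w m, 0 ≤ u ∧ u < p ∧ p < w ∧ w ≤ 1 ∧
      ∀ z ∈ Icc u w, H z = H u + m * (z - u)) :
    α y = α x := by
  have hd : ∀ p ∈ Icc x y, HasDerivAt α 0 p := by
    intro p hp
    obtain ⟨u, w, m, hu0, hup', hpw, hw1, hH⟩ := haff p hp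
    have hconst : ∀ z ∈ Ioo u w, α z = m := by
      intro z hz
      have h1 := hlow u z hu0 hz.1.le (hz.2.le.trans hw1)
      have h2 := hup z w (hu0.trans hz.1.le) hz.2.le hw1
      rw [hH z ⟨hz.1.le, hz.2.le⟩] at h1 h2
      rw [hH w ⟨(hz.1.trans hz.2).le, le_rfl⟩] at h2
      refine le_antisymm (le_of_mul_le_mul_right (a := z - u) ?_ (sub_pos.2 hz.1))
        (le_of_mul_le_mul_right (a := w - z) ?_ (sub_pos.2 hz.2)) <;> linarith
    refine (hasDerivAt_const p m).congr_of_eventuallyEq ?_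
    filter_upwards [Ioo_mem_nhds hup' hpw] with z hz using hconst z hz
  exact constant_of_has_deriv_right_zero
    (fun p hp => (hd p hp).continuousAt.continuousWithinAt)
    (fun p hp => (hd p ⟨hp.1, hp.2.le⟩).hasDerivWithinAt) y ⟨hxy, le_rfl⟩

theorem vfun_sq_div {a ahat : ℝ → ℝ} {s : ℝ} (h : 0 < ahat s) :
    vfun a ahat s ^ 2 / (2 * a s) = Real.log 2 * (a s * (ahat s)⁻¹) := by
  have hlog : 0 ≤ 2 * Real.log 2 / ahat s :=
    div_nonneg (mul_nonneg two_pos.le (Real.log_nonneg one_le_two)) h.le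
  rw [vfun, if_pos h, mul_pow, Real.sq_sqrt hlog]
  by_cases ha : a s = 0
  · simp [ha]
  · field_simp

theorem aemeasurable_vfun {a ahat : ℝ → ℝ} (ha : IntegrableOn a (Icc 0 1) volume)
    (hahat : AntitoneOn ahat (Ioc 0 1)) :
    AEMeasurable (vfun a ahat) (volume.restrict (Icc (0 : ℝ) 1)) := by
  have h1 : AEMeasurable ahat (volume.restrict (Icc (0 : ℝ) 1)) := by
    rw [← restrict_Ioc_eq_restrict_Icc]
    exact aemeasurable_restrict_of_antitoneOn measurableSet_Ioc hahat
  have h2 : Measurable fun x : ℝ => if 0 < x then Real.sqrt (2 * Real.log 2 / x) else 0 :=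
    Measurable.ite measurableSet_Ioi (by fun_prop) measurable_const
  refine (ha.aestronglyMeasurable.aemeasurable.mul (h2.comp_aemeasurable h1)).congr
    (Eventually.of_forall fun s => ?_)
  simp only [vfun, Pi.mul_apply, Function.comp_apply]
  split_ifs <;> simp

/-- The energy bound extends from the set where `ahat` is positive, since `vfun a ahat` vanishes
elsewhere. -/
theorem Ecost_vfun_le {a ahat : ℝ → ℝ} {t : ℝ} (ht : t ∈ Icc (0 : ℝ) 1)
    (hahat : AntitoneOn ahat (Ioc 0 1))
    (hpos : ∀ s ∈ Ioc (0 : ℝ) 1, 0 < ahat s →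
      Ecost a (vfun a ahat) s ≤ ENNReal.ofReal (Real.log 2 * s)) :
    Ecost a (vfun a ahat) t ≤ ENNReal.ofReal (Real.log 2 * t) := by
  rcases ht.1.eq_or_lt with rfl | ht0
  · simp [Ecost]
  obtain ⟨S, hS⟩ : ∃ S, S = {s | s ∈ Ioc (0 : ℝ) t ∧ 0 < ahat s} := ⟨_, rfl⟩
  have hzero : ∀ s, ¬ 0 < ahat s →
      (if a s = 0 then (if vfun a ahat s = 0 then 0 else ⊤)
        else ENNReal.ofReal (vfun a ahat s ^ 2 / (2 * a s))) = 0 := by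
    intro s hs
    simp [vfun, hs]
  have hbdd : BddAbove S := ⟨t, fun s hs => by rw [hS] at hs; exact hs.1.2⟩
  rcases S.eq_empty_or_nonempty with hempty | hne
  · have : Ecost a (vfun a ahat) t = 0 := by
      rw [Ecost, setLIntegral_congr_fun (g := fun _ => 0) measurableSet_Ioc]
      · simp
      · intro s hs
        refine hzero s fun h => ?_
        have : s ∈ S := by rw [hS]; exact ⟨hs, h⟩
        simp [hempty] at this
    rw [this]; exact zero_le
  obtain ⟨T, hT⟩ : ∃ T, T = sSup S := ⟨_, rfl⟩
  have hTt : T ≤ t := by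
    rw [hT]; exact csSup_le hne fun s hs => by rw [hS] at hs; exact hs.1.2
  have hT0 : 0 < T := by
    obtain ⟨s, hs⟩ := hne
    have h1 := le_csSup hbdd hs
    rw [hS] at hs
    rw [hT]; exact hs.1.1.trans_le h1
  obtain ⟨u, hu, hmem, hlim⟩ := exists_seq_strictMono_tendsto' hT0
  have hun : ⋃ n, Ioc 0 (u n) = Ioo 0 T := by
    ext s
    simp only [mem_iUnion, mem_Ioc, mem_Ioo]
    constructor
    · rintro ⟨n, h1, h2⟩
      exact ⟨h1, h2.trans_lt (hmem n).2⟩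
    · rintro ⟨h1, h2⟩
      obtain ⟨n, hn⟩ := (hlim.eventually (eventually_gt_nhds h2)).exists
      exact ⟨n, h1, hn.le⟩
  have hupos : ∀ n, 0 < ahat (u n) := by
    intro n
    have h := (hmem n).2
    rw [hT] at h
    obtain ⟨s, hs, hus⟩ := exists_lt_of_lt_csSup hne h
    rw [hS] at hs
    exact hs.2.trans_le (hahat ⟨(hmem n).1, (hus.le.trans hs.1.2).trans ht.2⟩
      ⟨hs.1.1, hs.1.2.trans ht.2⟩ hus.le)
  have hlog := Real.log_nonneg one_le_two
  rw [Ecost, ← Ioc_union_Ioc_eq_Ioc hT0.le hTt]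
  refine (lintegral_union_le _ _ _).trans ?_
  rw [setLIntegral_congr_fun (g := fun _ => 0) (s := Ioc T t) measurableSet_Ioc]
  · rw [lintegral_zero, add_zero, ← setLIntegral_congr Ioo_ae_eq_Ioc, ← hun,
      setLIntegral_iUnion_of_directed]
    · refine iSup_le fun n => (hpos (u n) ⟨(hmem n).1, ?_⟩ (hupos n)).trans ?_
      · exact (hmem n).2.le.trans (hTt.trans ht.2)
      · exact ENNReal.ofReal_le_ofReal
          (mul_le_mul_of_nonneg_left ((hmem n).2.le.trans hTt) hlog)
    · exact Monotone.directed_le fun i j hij => Ioc_subset_Ioc_right (hu.monotone hij)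
  · intro s hs
    refine hzero s fun h => ?_
    have h1 : s ∈ S := by rw [hS]; exact ⟨⟨hT0.trans hs.1, hs.2⟩, h⟩
    have := le_csSup hbdd h1
    rw [← hT] at this
    exact absurd hs.1 this.not_gt

theorem stmt10 (a A Ahat ahat : ℝ → ℝ)
    (ha_nonneg : ∀ s ∈ Set.Icc (0:ℝ) 1, 0 ≤ a s)
    (ha_int : RiemannIntegrableOn01 a)
    (hA : ∀ t ∈ Set.Icc (0:ℝ) 1, A t = ∫ s in (0:ℝ)..t, a s)
    (hA1 : A 1 = 1)
    (hAhat_conc : ConcaveOn ℝ (Set.Icc 0 1) Ahat)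
    (hAhat_ge : ∀ t ∈ Set.Icc (0:ℝ) 1, A t ≤ Ahat t)
    (hAhat_least : ∀ g : ℝ → ℝ, ConcaveOn ℝ (Set.Icc 0 1) g →
      (∀ t ∈ Set.Icc (0:ℝ) 1, A t ≤ g t) → ∀ t ∈ Set.Icc (0:ℝ) 1, Ahat t ≤ g t)
    (hahat_deriv : ∀ t ∈ Set.Ioc (0:ℝ) 1, HasDerivWithinAt Ahat (ahat t) (Set.Iic t) t)
    (hahat_nonneg : ∀ t ∈ Set.Ioc (0:ℝ) 1, 0 ≤ ahat t)
    (hahat_anti : AntitoneOn ahat (Set.Ioc 0 1)) :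
    (∀ t ∈ Set.Icc (0:ℝ) 1, 0 < ahat t →
      (∫ s in Set.Ioc (0:ℝ) t, (vfun a ahat s) ^ 2 / (2 * a s)) =
        Real.log 2 * (t - (Ahat t - A t) / ahat t)) ∧
    (∀ t ∈ Set.Icc (0:ℝ) 1, Ecost a (vfun a ahat) t ≤ ENNReal.ofReal (Real.log 2 * t)) ∧
    memR a (vfun a ahat) := by
  obtain ⟨hai, -, C₀, hC₀⟩ := ha_int
  obtain ⟨C, hC⟩ : ∃ C, C = max C₀ 1 := ⟨_, rfl⟩
  have hC0 : 0 < C := by rw [hC]; exact one_pos.trans_le (le_max_right _ _)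
  have haC : ∀ s ∈ Icc (0 : ℝ) 1, a s ≤ C := fun s hs =>
    (le_abs_self _).trans ((hC₀ s hs).trans (by rw [hC]; exact le_max_left _ _))
  have hai' : ∀ x y, 0 ≤ x → x ≤ y → y ≤ 1 → IntervalIntegrable a volume x y :=
    fun x y hx hxy hy => (intervalIntegrable_iff_integrableOn_Icc_of_le hxy).2
      (hai.mono_set (Icc_subset_Icc hx hy))
  have hAsub : ∀ x y, 0 ≤ x → x ≤ y → y ≤ 1 → A y - A x = ∫ s in x..y, a s := by
    intro x y hx hxy hy
    rw [hA y ⟨by linarith, hy⟩, hA x ⟨hx, by linarith⟩]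
    exact intervalIntegral.integral_interval_sub_left (hai' 0 y le_rfl (by linarith) hy)
      (hai' 0 x le_rfl hx (by linarith))
  have hAmono : MonotoneOn A (Icc 0 1) := by
    intro x hx y hy hxy
    rw [← sub_nonneg, hAsub x y hx.1 hxy hy.2]
    exact intervalIntegral.integral_nonneg hxy fun s hs =>
      ha_nonneg s ⟨hx.1.trans hs.1, hs.2.trans hy.2⟩
  have hAlip : ∀ x y, 0 ≤ x → x ≤ y → y ≤ 1 → A y - A x ≤ C * (y - x) := by
    intro x y hx hxy hy
    have h := intervalIntegral.integral_mono_on hxy (hai' x y hx hxy hy)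
      (intervalIntegrable_const (c := C)) fun s hs => haC s ⟨hx.trans hs.1, hs.2.trans hy⟩
    rw [intervalIntegral.integral_const, smul_eq_mul] at h
    rw [hAsub x y hx hxy hy]
    linarith
  have hA0 : A 0 = 0 := by simpa using hA 0 (by simp)
  have hHC : ∀ t ∈ Icc (0 : ℝ) 1, Ahat t ≤ C * t := by
    refine hAhat_least (fun t => C * t) ⟨convex_Icc _ _, fun u _ w _ c d _ _ _ => le_of_eq ?_⟩
      fun t ht => ?_
    · simp only [smul_eq_mul]; ring
    · have := hAlip 0 t le_rfl ht.1 ht.2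
      rwa [hA0, sub_zero, sub_zero] at this
  have hH0 : Ahat 0 = 0 := by
    have h1 := hHC 0 (by simp)
    have h2 := hAhat_ge 0 (by simp)
    linarith
  have hH1 : Ahat 1 ≤ 1 := hAhat_least (fun _ => 1) (concaveOn_const 1 (convex_Icc 0 1))
    (fun t ht => hA1 ▸ hAmono ht (by simp) ht.2) 1 (by simp)
  -- `α` extends `ahat` to the left endpoint by an upper bound.
  obtain ⟨α, hα0, hαpos⟩ : ∃ α : ℝ → ℝ, α 0 = C ∧ ∀ s, 0 < s → α s = ahat s :=
    ⟨fun s => if s ≤ 0 then C else ahat s, by simp, fun s hs => by simp [hs]⟩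
  have hlow : ∀ x y, 0 ≤ x → x ≤ y → y ≤ 1 → α y * (y - x) ≤ Ahat y - Ahat x := by
    intro x y hx hxy hy
    rcases (hx.trans hxy).eq_or_lt with h | h
    · obtain rfl : x = y := by linarith
      simp
    · rw [hαpos y h]
      exact hAhat_conc.mul_le_sub_of_hasDerivWithinAt_Iic hx hxy hy (hahat_deriv y ⟨h, hy⟩)
  have hup : ∀ x y, 0 ≤ x → x ≤ y → y ≤ 1 → Ahat y - Ahat x ≤ α x * (y - x) := by
    intro x y hx hxy hy
    rcases hx.eq_or_lt with rfl | h
    · rw [hα0, hH0, sub_zero, sub_zero]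
      exact hHC y ⟨hxy, hy⟩
    · rw [hαpos x h]
      exact hAhat_conc.sub_le_mul_of_hasDerivWithinAt_Iic h hxy hy
        (hahat_deriv x ⟨h, hxy.trans hy⟩)
  have hαC : ∀ s ∈ Icc (0 : ℝ) 1, α s ≤ C := by
    intro s hs
    rcases hs.1.eq_or_lt with rfl | h
    · exact hα0.le
    · have h1 := hlow 0 s le_rfl hs.1 hs.2
      have h2 := hHC s hs
      rw [hH0, sub_zero, sub_zero] at h1
      exact le_of_mul_le_mul_right (h1.trans h2) h
  have hαnonneg : ∀ s ∈ Icc (0 : ℝ) 1, 0 ≤ α s := by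
    intro s hs
    rcases hs.1.eq_or_lt with rfl | h
    · exact hα0 ▸ hC0.le
    · rw [hαpos s h]; exact hahat_nonneg s ⟨h, hs.2⟩
  have hαanti : AntitoneOn α (Icc 0 1) := by
    intro x hx y hy hxy
    rcases hx.1.eq_or_lt with rfl | h
    · rw [hα0]; exact hαC y hy
    · rw [hαpos x h, hαpos y (h.trans_le hxy)]
      exact hahat_anti ⟨h, hx.2⟩ ⟨h.trans_le hxy, hy.2⟩ hxy
  have hHmono : MonotoneOn Ahat (Icc 0 1) := fun x hx y hy hxy => sub_nonneg.1
    ((mul_nonneg (hαnonneg y hy) (sub_nonneg.2 hxy)).trans (hlow x y hx.1 hxy hy.2))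
  have hHlip : ∀ x y, 0 ≤ x → x ≤ y → y ≤ 1 → Ahat y - Ahat x ≤ C * (y - x) :=
    fun x y hx hxy hy => (hup x y hx hxy hy).trans
      (mul_le_mul_of_nonneg_right (hαC x ⟨hx, hxy.trans hy⟩) (sub_nonneg.2 hxy))
  have hflat : ∀ x y, 0 ≤ x → x ≤ y → y ≤ 1 → α y < α x → ∃ z ∈ Icc x y, A z = Ahat z := by
    intro x y hx hxy hy hlt
    by_contra! hne
    refine hlt.ne (eq_left_of_locally_affine hxy hlow hup fun p hp => ?_)
    have hpm : p ∈ Icc (0 : ℝ) 1 := ⟨hx.trans hp.1, hp.2.trans hy⟩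
    have hpne := hne p hp
    refine exists_affine_of_lt_least_concave hC0 hAhat_conc hAhat_ge hAhat_least hAmono hHmono
      hAlip hHlip ⟨hpm.1.lt_of_ne ?_, hpm.2.lt_of_ne ?_⟩ ((hAhat_ge p hpm).lt_of_ne hpne)
    · rintro rfl
      exact hpne (hA0.trans hH0.symm)
    · rintro rfl
      exact hpne (le_antisymm (hAhat_ge 1 hpm) (hH1.trans hA1.ge))
  have hmain : ∀ t ∈ Ioc (0 : ℝ) 1, 0 < ahat t →
      IntegrableOn (fun s => vfun a ahat s ^ 2 / (2 * a s)) (Ioc 0 t) volume ∧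
      ∫ s in Ioc (0 : ℝ) t, vfun a ahat s ^ 2 / (2 * a s) =
        Real.log 2 * (t - (Ahat t - A t) / ahat t) := by
    intro t ht hpos
    obtain ⟨h1, h2⟩ := integral_mul_inv_eq ha_nonneg hai hA hAlip hAhat_ge hαanti hαnonneg hαC
      hlow hup hH0 hflat ⟨ht.1.le, ht.2⟩ (hαpos t ht.1 ▸ hpos)
    have heq : EqOn (fun s => vfun a ahat s ^ 2 / (2 * a s))
        (fun s => Real.log 2 * (a s * (α s)⁻¹)) (Ioc 0 t) := by
      intro s hs
      simp only
      rw [hαpos s hs.1]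
      exact vfun_sq_div (hpos.trans_le (hahat_anti ⟨hs.1, hs.2.trans ht.2⟩ ht hs.2))
    rw [hαpos t ht.1] at h2
    refine ⟨(integrableOn_congr_fun heq measurableSet_Ioc).2 (h1.const_mul _), ?_⟩
    rw [setIntegral_congr_fun measurableSet_Ioc heq, integral_const_mul, ← h2,
      intervalIntegral.integral_of_le ht.1.le]
  have hE : ∀ t ∈ Icc (0 : ℝ) 1,
      Ecost a (vfun a ahat) t ≤ ENNReal.ofReal (Real.log 2 * t) := by
    refine fun t ht => Ecost_vfun_le ht hahat_anti fun s hs hpos => ?_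
    obtain ⟨h1, h2⟩ := hmain s hs hpos
    have hnn : ∀ r ∈ Ioc (0 : ℝ) s, 0 ≤ vfun a ahat r ^ 2 / (2 * a r) := fun r hr =>
      div_nonneg (sq_nonneg _)
        (mul_nonneg two_pos.le (ha_nonneg r ⟨hr.1.le, hr.2.trans hs.2⟩))
    have heq : Ecost a (vfun a ahat) s =
        ENNReal.ofReal (∫ r in Ioc (0 : ℝ) s, vfun a ahat r ^ 2 / (2 * a r)) := by
      rw [ofReal_integral_eq_lintegral_ofReal h1
        ((ae_restrict_iff' measurableSet_Ioc).2 (Eventually.of_forall hnn)), Ecost]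
      refine lintegral_congr fun r => ?_
      by_cases har : a r = 0
      · simp [har, vfun]
      · simp [har]
    rw [heq, h2]
    refine ENNReal.ofReal_le_ofReal (mul_le_mul_of_nonneg_left ?_ (Real.log_nonneg one_le_two))
    have := div_nonneg (sub_nonneg.2 (hAhat_ge s ⟨hs.1.le, hs.2⟩)) hpos.le
    linarith
  refine ⟨fun t ht hpos => ?_, hE, aemeasurable_vfun hai hahat_anti, hE⟩
  rcases ht.1.eq_or_lt with rfl | h
  · simp [hA0, hH0]
  · exact (hmain t ⟨h, ht.2⟩ hpos).2
end

section
/- ∫₀¹ √(â(s)) ds ≤ 1, with equality if and only if Â(t) = t for all t ∈ [0,1], which holds if and only if A(t) ≤ t for all t ∈ [0,1]. -/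
open MeasureTheory Set Filter

/-- The fundamental theorem of calculus for a nonnegative left derivative, including its
integrability. -/
theorem integrableOn_and_integral_eq_sub_of_hasDeriv_left_of_nonneg {F F' : ℝ → ℝ} {a b : ℝ}
    (hab : a ≤ b) (hcont : ContinuousOn F (Icc a b))
    (hderiv : ∀ x ∈ Ioo a b, HasDerivWithinAt F (F' x) (Iio x) x)
    (hpos : ∀ x ∈ Ioo a b, 0 ≤ F' x) :
    IntegrableOn F' (Ioc a b) ∧ ∫ x in a..b, F' x = F b - F a := by
  have hmem : ∀ x ∈ Ioo (-b) (-a), -x ∈ Ioo a b := fun x hx =>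
    ⟨by linarith [hx.2], by linarith [hx.1]⟩
  have hcont' : ContinuousOn (fun x => -F (-x)) (Icc (-b) (-a)) :=
    (hcont.comp continuous_neg.continuousOn fun x hx =>
      ⟨by linarith [hx.2], by linarith [hx.1]⟩).neg
  have hderiv' : ∀ x ∈ Ioo (-b) (-a),
      HasDerivWithinAt (fun x => -F (-x)) (F' (-x)) (Ioi x) x := fun x hx => by
    have h := ((hderiv _ (hmem x hx)).scomp x (hasDerivAt_neg x).hasDerivWithinAt
      (s := Ioi x) fun y (hy : x < y) => neg_lt_neg hy).neg
    simpa [Function.comp_def, Pi.neg_def] using h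
  have hint : IntervalIntegrable (fun x => F' (-x)) volume (-b) (-a) :=
    (intervalIntegrable_iff_integrableOn_Ioc_of_le (neg_le_neg hab)).2
      (intervalIntegral.integrableOn_deriv_right_of_nonneg hcont' hderiv'
        fun x hx => hpos _ (hmem x hx))
  have hFTC := intervalIntegral.integral_eq_sub_of_hasDeriv_right_of_le
    (neg_le_neg hab) hcont' hderiv' hint
  rw [intervalIntegral.integral_comp_neg (fun x => F' x)] at hFTC
  refine ⟨?_, by simpa [sub_eq_add_neg, add_comm] using hFTC⟩
  rw [← intervalIntegrable_iff_integrableOn_Ioc_of_le hab]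
  simpa using (hint.comp_sub_left 0).symm

/-- If `f ≥ 0` has integral `1` on `(0,1]`, then `√f` is integrable with integral at most `1`,
and equality forces `f = 1` almost everywhere. -/
theorem integral_sqrt_le_one_of_integral_eq_one {f : ℝ → ℝ}
    (hf : IntegrableOn f (Ioc 0 1)) (hpos : ∀ x ∈ Ioc (0:ℝ) 1, 0 ≤ f x)
    (hone : ∫ x in Ioc (0:ℝ) 1, f x = 1) :
    (∫ x in Ioc (0:ℝ) 1, Real.sqrt (f x)) ≤ 1 ∧
    ((∫ x in Ioc (0:ℝ) 1, Real.sqrt (f x)) = 1 →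
      ∀ᵐ x ∂(volume.restrict (Ioc (0:ℝ) 1)), f x = 1) := by
  have hmem : ∀ᵐ x ∂(volume.restrict (Ioc (0:ℝ) 1)), x ∈ Ioc (0:ℝ) 1 :=
    ae_restrict_mem measurableSet_Ioc
  have hmid : IntegrableOn (fun x => (1 + f x) / 2) (Ioc 0 1) :=
    ((integrable_const (1:ℝ)).add hf).div_const 2
  have hsqrt : IntegrableOn (fun x => Real.sqrt (f x)) (Ioc 0 1) := by
    refine Integrable.mono' hmid
      (Real.continuous_sqrt.comp_aestronglyMeasurable hf.aestronglyMeasurable) ?_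
    filter_upwards [hmem] with x hx
    rw [Real.norm_of_nonneg (Real.sqrt_nonneg _)]
    nlinarith [Real.sq_sqrt (hpos x hx), sq_nonneg (1 - Real.sqrt (f x))]
  have hgap : 0 ≤ᵐ[volume.restrict (Ioc (0:ℝ) 1)]
      fun x => (1 + f x) / 2 - Real.sqrt (f x) := by
    filter_upwards [hmem] with x hx
    simp only [Pi.zero_apply]
    nlinarith [Real.sq_sqrt (hpos x hx), sq_nonneg (1 - Real.sqrt (f x))]
  have hgap_int : ∫ x in Ioc (0:ℝ) 1, ((1 + f x) / 2 - Real.sqrt (f x)) =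
      1 - ∫ x in Ioc (0:ℝ) 1, Real.sqrt (f x) := by
    rw [integral_sub hmid hsqrt, integral_div, integral_add (integrable_const (1:ℝ)) hf, hone]
    norm_num
  refine ⟨by linarith [integral_nonneg_of_ae hgap], fun heq => ?_⟩
  have hzero := (integral_eq_zero_iff_of_nonneg_ae hgap (hmid.sub hsqrt)).1
    (by rw [hgap_int, heq, sub_self])
  filter_upwards [hzero, hmem] with x hx hx'
  simp only [Pi.zero_apply] at hx
  have hsq := Real.sq_sqrt (hpos x hx')
  have h1 : Real.sqrt (f x) = 1 := by nlinarith [sq_nonneg (1 - Real.sqrt (f x))]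
  rw [← hsq, h1, one_pow]

theorem stmt12 (a A Ahat ahat : ℝ → ℝ)
    (ha_nonneg : ∀ s ∈ Set.Icc (0:ℝ) 1, 0 ≤ a s)
    (ha_int : RiemannIntegrableOn01 a)
    (hA : ∀ t ∈ Set.Icc (0:ℝ) 1, A t = ∫ s in (0:ℝ)..t, a s)
    (hA1 : A 1 = 1)
    (hAhat_conc : ConcaveOn ℝ (Set.Icc 0 1) Ahat)
    (hAhat_ge : ∀ t ∈ Set.Icc (0:ℝ) 1, A t ≤ Ahat t)
    (hAhat_least : ∀ g : ℝ → ℝ, ConcaveOn ℝ (Set.Icc 0 1) g →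
      (∀ t ∈ Set.Icc (0:ℝ) 1, A t ≤ g t) → ∀ t ∈ Set.Icc (0:ℝ) 1, Ahat t ≤ g t)
    (hahat_deriv : ∀ t ∈ Set.Ioc (0:ℝ) 1, HasDerivWithinAt Ahat (ahat t) (Set.Iic t) t)
    (hahat_nonneg : ∀ t ∈ Set.Ioc (0:ℝ) 1, 0 ≤ ahat t)
    (hahat_anti : AntitoneOn ahat (Set.Ioc 0 1)) :
    (∫ s in Set.Ioc (0:ℝ) 1, Real.sqrt (ahat s)) ≤ 1 ∧
    ((∫ s in Set.Ioc (0:ℝ) 1, Real.sqrt (ahat s)) = 1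
      ↔ ∀ t ∈ Set.Icc (0:ℝ) 1, Ahat t = t) ∧
    ((∀ t ∈ Set.Icc (0:ℝ) 1, Ahat t = t) ↔ ∀ t ∈ Set.Icc (0:ℝ) 1, A t ≤ t) := by
  obtain ⟨ha_io, -, C, hC⟩ := ha_int
  have h0 : (0:ℝ) ∈ Icc (0:ℝ) 1 := ⟨le_rfl, zero_le_one⟩
  have h1 : (1:ℝ) ∈ Icc (0:ℝ) 1 := ⟨zero_le_one, le_rfl⟩
  have ha_ii : IntervalIntegrable a volume 0 1 :=
    (intervalIntegrable_iff_integrableOn_Icc_of_le zero_le_one).2 ha_io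
  have hA_nonneg : ∀ t ∈ Icc (0:ℝ) 1, 0 ≤ A t := fun t ht => by
    rw [hA t ht]
    exact intervalIntegral.integral_nonneg ht.1 fun s hs => ha_nonneg s ⟨hs.1, hs.2.trans ht.2⟩
  have hA_le_one : ∀ t ∈ Icc (0:ℝ) 1, A t ≤ 1 := fun t ht => by
    rw [← hA1, hA t ht, hA 1 h1]
    refine intervalIntegral.integral_mono_interval le_rfl ht.1 ht.2 ?_ ha_ii
    filter_upwards [ae_restrict_mem measurableSet_Ioc] with s hs
    exact ha_nonneg s ⟨hs.1.le, hs.2⟩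
  have hA_le_mul : ∀ t ∈ Icc (0:ℝ) 1, A t ≤ t * C := fun t ht => by
    rw [hA t ht]
    have h := intervalIntegral.integral_mono_on (g := fun _ => C) ht.1
      (ha_ii.mono_set (by
        rw [uIcc_of_le ht.1, uIcc_of_le zero_le_one]
        exact Icc_subset_Icc_right ht.2))
      intervalIntegrable_const
      fun s hs => (le_abs_self _).trans (hC s ⟨hs.1, hs.2.trans ht.2⟩)
    simpa using h
  have hmul_conc : ConcaveOn ℝ (Icc (0:ℝ) 1) fun t => t * C :=
    ((LinearMap.mulRight ℝ C).concaveOn (convex_Icc 0 1))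
  have hAhat_le_mul := hAhat_least _ hmul_conc hA_le_mul
  have hAhat_nonneg : ∀ t ∈ Icc (0:ℝ) 1, 0 ≤ Ahat t := fun t ht =>
    (hA_nonneg t ht).trans (hAhat_ge t ht)
  have hAhat0 : Ahat 0 = 0 :=
    le_antisymm (by simpa using hAhat_le_mul 0 h0) (hAhat_nonneg 0 h0)
  have hAhat1 : Ahat 1 = 1 :=
    le_antisymm (hAhat_least _ (concaveOn_const 1 (convex_Icc 0 1)) hA_le_one 1 h1)
      (hA1.ge.trans (hAhat_ge 1 h1))
  have hid_le : ∀ t ∈ Icc (0:ℝ) 1, t ≤ Ahat t := fun t ht => by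
    have h := hAhat_conc.2 h0 h1 (sub_nonneg.2 ht.2) ht.1 (sub_add_cancel 1 t)
    simpa [hAhat0, hAhat1] using h
  have hcont : ContinuousOn Ahat (Icc 0 1) := by
    intro t ht
    rcases ht.1.eq_or_lt with rfl | ht0
    · refine tendsto_of_tendsto_of_tendsto_of_le_of_le' (g := fun _ => 0) (h := fun t => t * C)
        (by rw [hAhat0]; exact tendsto_const_nhds) ?_ ?_ ?_
      · rw [hAhat0]
        have h : Continuous fun t : ℝ => t * C := by fun_prop
        simpa using (h.tendsto 0).mono_left nhdsWithin_le_nhds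
      · filter_upwards [self_mem_nhdsWithin] with s hs using hAhat_nonneg s hs
      · filter_upwards [self_mem_nhdsWithin] with s hs using hAhat_le_mul s hs
    rcases ht.2.eq_or_lt with rfl | ht1
    · exact (hahat_deriv 1 ⟨ht0, le_rfl⟩).continuousWithinAt.mono Icc_subset_Iic_self
    · have hcont_int := hAhat_conc.continuousOn_interior
      rw [interior_Icc] at hcont_int
      exact (hcont_int.continuousAt (Ioo_mem_nhds ht0 ht1)).continuousWithinAt
  have hFTC : ∀ t ∈ Icc (0:ℝ) 1,
      IntegrableOn ahat (Ioc 0 t) ∧ ∫ s in (0:ℝ)..t, ahat s = Ahat t := fun t ht => by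
    have h := integrableOn_and_integral_eq_sub_of_hasDeriv_left_of_nonneg ht.1
      (hcont.mono (Icc_subset_Icc_right ht.2))
      (fun s hs => (hahat_deriv s ⟨hs.1, hs.2.le.trans ht.2⟩).mono Iio_subset_Iic_self)
      (fun s hs => hahat_nonneg s ⟨hs.1, hs.2.le.trans ht.2⟩)
    rwa [hAhat0, sub_zero] at h
  obtain ⟨hle, heq⟩ := integral_sqrt_le_one_of_integral_eq_one (hFTC 1 h1).1 hahat_nonneg
    (by rw [← intervalIntegral.integral_of_le zero_le_one, (hFTC 1 h1).2, hAhat1])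
  refine ⟨hle, ⟨fun h t ht => ?_, fun h => ?_⟩, fun h t ht => (hAhat_ge t ht).trans (h t ht).le,
    fun h t ht => le_antisymm (hAhat_least _ (concaveOn_id (convex_Icc 0 1)) h t ht)
      (hid_le t ht)⟩
  · rw [← (hFTC t ht).2, intervalIntegral.integral_of_le ht.1,
      integral_congr_ae (g := fun _ => (1:ℝ))
        (ae_restrict_of_ae_restrict_of_subset (Ioc_subset_Ioc_right ht.2) (heq h)),
      ← intervalIntegral.integral_of_le ht.1]
    simp
  · have hone : ∀ s ∈ Ioc (0:ℝ) 1, ahat s = 1 := fun s hs => by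
      refine (uniqueDiffWithinAt_Iic s).eq_deriv _ (hahat_deriv s hs) ?_
      refine (hasDerivWithinAt_id s (Iic s)).congr_of_eventuallyEq ?_ (h s ⟨hs.1.le, hs.2⟩)
      filter_upwards [self_mem_nhdsWithin, mem_nhdsWithin_of_mem_nhds (Ioi_mem_nhds hs.1)]
        with u hu hu0
      exact h u ⟨le_of_lt hu0, le_trans hu hs.2⟩
    rw [setIntegral_congr_fun (g := fun _ => (1:ℝ)) measurableSet_Ioc
      fun s hs => by simp [hone s hs]]
    simp
end
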